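/- arXiv:2005.12603 — 6 statements merged into one kernel-verified Lean document; each statement's English description precedes it below -/
import Mathlib

section
/- For every integer n ≥ 1 and every balanced necklace with n red and n blue beads, there exists a proper heterogeneous matching of size at least ⌈n/2⌉. -/
def strictBtw {N : ℕ} (a x b : Fin N) : Prop :=
  0 < (x - a).val ∧ (x - a).val < (b - a).val

def Crosses {N : ℕ} (p q : Fin N × Fin N) : Prop :=
  (strictBtw p.1 q.1 p.2 ∧ strictBtw p.2 q.2 p.1) ∨
  (strictBtw p.1 q.2 p.2 ∧ strictBtw p.2 q.1 p.1)

def IsMatching {N : ℕ} (M : Finset (Fin N × Fin N)) : Prop :=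
  (∀ p ∈ M, p.1 ≠ p.2) ∧
  ∀ p ∈ M, ∀ q ∈ M, p ≠ q →
    p.1 ≠ q.1 ∧ p.1 ≠ q.2 ∧ p.2 ≠ q.1 ∧ p.2 ≠ q.2

def CrossFree {N : ℕ} (M : Finset (Fin N × Fin N)) : Prop :=
  ∀ p ∈ M, ∀ q ∈ M, ¬ Crosses p q

def InArc {N : ℕ} (k : Fin N) (m : ℕ) (x : Fin N) : Prop :=
  (x - k).val < m

def RespectsSecant {N : ℕ} (M : Finset (Fin N × Fin N)) (k : Fin N) (m : ℕ) : Prop :=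
  0 < m ∧ m < N ∧ ∀ p ∈ M, Xor' (InArc k m p.1) (InArc k m p.2)

def SecantRespecting {N : ℕ} (M : Finset (Fin N × Fin N)) : Prop :=
  ∃ k m, RespectsSecant M k m

def IsProper {N : ℕ} (M : Finset (Fin N × Fin N)) : Prop :=
  CrossFree M ∧ SecantRespecting M

def Heterogeneous {N : ℕ} (c : Fin N → Bool) (M : Finset (Fin N × Fin N)) : Prop :=
  ∀ p ∈ M, c p.1 ≠ c p.2

def Homogeneous {N : ℕ} (c : Fin N → Bool) (M : Finset (Fin N × Fin N)) : Prop :=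
  ∀ p ∈ M, c p.1 = c p.2

def redCount {N : ℕ} (c : Fin N → Bool) : ℕ :=
  (Finset.univ.filter fun i => c i = true).card

def monoCount {N : ℕ} (c : Fin N → Bool) : ℕ :=
  (Finset.univ.filter fun i : Fin N =>
    c i ≠ c ⟨(i.val + 1) % N, Nat.mod_lt _ i.pos⟩).card

theorem Fin.val_sub_eq_ite {N : ℕ} (x a : Fin N) :
    (x - a).val = if a.val ≤ x.val then x.val - a.val else N + x.val - a.val := by
  have := x.isLt
  have := a.isLt
  rw [Fin.sub_def]
  split_ifs with h
  · have e : N - a.val + x.val = x.val - a.val + N := by omega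
    simp only [e, Nat.add_mod_right]
    exact Nat.mod_eq_of_lt (by omega)
  · have e : N - a.val + x.val = N + x.val - a.val := by omega
    simp only [e]
    exact Nat.mod_eq_of_lt (by omega)

/-- Nested pairs do not cross: here `p` and `q` both run from `[0, m)` to `[m, N)`. -/
theorem not_crosses_of_nested {N m : ℕ} {p q : Fin N × Fin N}
    (hp₁ : p.1.val < m) (hp₂ : m ≤ p.2.val) (hq₁ : q.1.val < m) (hq₂ : m ≤ q.2.val)
    (h : p.1 < q.1 ∧ q.2 < p.2 ∨ q.1 < p.1 ∧ p.2 < q.2 ∨ p = q) : ¬ Crosses p q := by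
  have := p.1.isLt
  have := p.2.isLt
  have := q.1.isLt
  have := q.2.isLt
  rcases h with h | h | rfl
  all_goals
    simp only [Crosses, strictBtw, Fin.val_sub_eq_ite]
    try simp only [Fin.lt_def] at h
    split_ifs <;> omega

/-- Equinumerous sets of beads in `[0, m)` and in `[m, N)` can be matched by a proper matching. -/
theorem exists_proper_matching {N m : ℕ} (hm : 0 < m) (hmN : m < N) (S T : Finset (Fin N))
    (hS : ∀ i ∈ S, i.val < m) (hT : ∀ i ∈ T, m ≤ i.val) (hST : S.card = T.card) :
    ∃ M : Finset (Fin N × Fin N), IsMatching M ∧ IsProper M ∧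
      (∀ p ∈ M, p.1 ∈ S ∧ p.2 ∈ T) ∧ M.card = S.card := by
  let s := S.orderEmbOfFin rfl
  let t := T.orderEmbOfFin hST.symm
  have hs : ∀ i, s i ∈ S := S.orderEmbOfFin_mem rfl
  have ht : ∀ i, t i ∈ T := T.orderEmbOfFin_mem hST.symm
  have hs' := fun i => hS _ (hs i)
  have ht' := fun i => hT _ (ht i)
  have ne_of : ∀ i j, s i ≠ t j := fun i j h => by
    have := hs' i
    have := ht' j
    rw [h] at *
    omega
  let f : Fin S.card → Fin N × Fin N := fun i => (s i, t i.rev)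
  have hf : Function.Injective f := fun i j h => s.injective (congrArg Prod.fst h)
  refine ⟨Finset.univ.image f, ⟨?_, ?_⟩, ⟨?_, ⟨0, by omega⟩, m, hm, hmN, ?_⟩, ?_, ?_⟩
  · simp only [Finset.mem_image, Finset.mem_univ, true_and]
    rintro _ ⟨i, rfl⟩
    exact ne_of _ _
  · simp only [Finset.mem_image, Finset.mem_univ, true_and]
    rintro _ ⟨i, rfl⟩ _ ⟨j, rfl⟩ h
    have hij : i ≠ j := fun e => h (congrArg f e)
    exact ⟨fun e => hij (s.injective e), ne_of _ _, (ne_of _ _).symm,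
      fun e => hij (Fin.rev_injective (t.injective e))⟩
  · simp only [CrossFree, Finset.mem_image, Finset.mem_univ, true_and]
    rintro _ ⟨i, rfl⟩ _ ⟨j, rfl⟩
    refine not_crosses_of_nested (hs' i) (ht' i.rev) (hs' j) (ht' j.rev) ?_
    rcases lt_trichotomy i j with h | h | h
    · exact .inl ⟨s.strictMono h, t.strictMono (Fin.rev_lt_rev.2 h)⟩
    · exact .inr (.inr (congrArg f h))
    · exact .inr (.inl ⟨s.strictMono h, t.strictMono (Fin.rev_lt_rev.2 h)⟩)
  · simp only [Finset.mem_image, Finset.mem_univ, true_and]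
    rintro _ ⟨i, rfl⟩
    have h₁ := hs' i
    have h₂ := ht' i.rev
    refine .inl ⟨?_, ?_⟩ <;> simp only [InArc, Fin.val_sub_eq_ite, f] <;> simpa
  · simp only [Finset.mem_image, Finset.mem_univ, true_and]
    rintro _ ⟨i, rfl⟩
    exact ⟨hs i, ht i.rev⟩
  · rw [Finset.card_image_of_injective _ hf, Finset.card_univ, Fintype.card_fin]

/-- every balanced necklace with n red and n blue beads has a proper
heterogeneous matching of size at least ⌈n/2⌉. -/
theorem stmt0 (n : ℕ) (hn : 1 ≤ n) (c : Fin (2 * n) → Bool) (hbal : redCount c = n) :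
    ∃ M : Finset (Fin (2 * n) × Fin (2 * n)),
      IsMatching M ∧ IsProper M ∧ Heterogeneous c M ∧ (n + 1) / 2 ≤ M.card := by
  have hred : (Finset.univ.filter fun i => c i = true).card = n := hbal
  have hlow : (Finset.univ.filter fun i : Fin (2 * n) => i.val < n).card = n := by
    rw [Fin.card_filter_val_lt]
    omega
  have hhigh := Finset.card_filter_add_card_filter_not
    (s := Finset.univ) fun i : Fin (2 * n) => i.val < n
  have key : ∀ b, (Finset.univ.filter fun i => i.val < n ∧ c i = b).card =
      (Finset.univ.filter fun i => ¬ i.val < n ∧ c i = !b).card ∧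
      (n + 1) / 2 ≤ (Finset.univ.filter fun i => i.val < n ∧ c i = b).card →
      ∃ M : Finset (Fin (2 * n) × Fin (2 * n)),
        IsMatching M ∧ IsProper M ∧ Heterogeneous c M ∧ (n + 1) / 2 ≤ M.card := by
    rintro b ⟨hcard, hle⟩
    obtain ⟨M, hM, hP, hmem, hMc⟩ := exists_proper_matching (by omega) (by omega) _ _
      (fun i hi => (Finset.mem_filter.1 hi).2.1)
      (fun i hi => not_lt.1 (Finset.mem_filter.1 hi).2.1) hcard
    refine ⟨M, hM, hP, fun p hp => ?_, hMc ▸ hle⟩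
    obtain ⟨h₁, h₂⟩ := hmem p hp
    rw [(Finset.mem_filter.1 h₁).2.2, (Finset.mem_filter.1 h₂).2.2]
    cases b <;> simp
  have e₁ := Finset.card_filter_add_card_filter_not
    (s := Finset.univ.filter fun i : Fin (2 * n) => i.val < n) fun i => c i = true
  have e₂ := Finset.card_filter_add_card_filter_not
    (s := Finset.univ.filter fun i : Fin (2 * n) => ¬ i.val < n) fun i => c i = true
  have e₃ := Finset.card_filter_add_card_filter_not
    (s := Finset.univ.filter fun i => c i = true) fun i : Fin (2 * n) => i.val < n
  simp only [Finset.filter_filter, Bool.not_eq_true, and_comm (a := c _ = true)] at e₁ e₂ e₃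
  rw [Finset.card_univ, Fintype.card_fin] at hhigh
  rcases le_or_gt ((n + 1) / 2)
    (Finset.univ.filter fun i : Fin (2 * n) => i.val < n ∧ c i = true).card with h | h
  · refine key true ⟨?_, h⟩
    simp only [Bool.not_true]
    omega
  · refine key false ⟨?_, ?_⟩
    · simp only [Bool.not_false]
      omega
    · omega
end

section
/- For every integer n ≥ 1 and every balanced necklace with n red and n blue beads, there exists a proper homogeneous matching of size at least ⌊n/2⌋. -/
theorem strictBtw_iff_of_lt {N : ℕ} {a b x : Fin N} (h : a < b) :
    strictBtw a x b ↔ a < x ∧ x < b := by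
  have hb := Fin.coe_sub_iff_le.2 h.le
  unfold strictBtw
  rcases le_or_gt a x with hx | hx
  · have hxa := Fin.coe_sub_iff_le.2 hx
    grind
  · have hxa := Fin.coe_sub_iff_lt.2 hx
    grind

theorem strictBtw_iff_of_gt {N : ℕ} {a b x : Fin N} (h : b < a) :
    strictBtw a x b ↔ a < x ∨ x < b := by
  have hb := Fin.coe_sub_iff_lt.2 h
  unfold strictBtw
  rcases le_or_gt a x with hx | hx
  · have hxa := Fin.coe_sub_iff_le.2 hx
    grind
  · have hxa := Fin.coe_sub_iff_lt.2 hx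
    grind

theorem crosses_iff_of_lt {N : ℕ} {p q : Fin N × Fin N} (hp : p.1 < p.2) :
    Crosses p q ↔
      ((p.1 < q.1 ∧ q.1 < p.2) ∧ (p.2 < q.2 ∨ q.2 < p.1)) ∨
      ((p.1 < q.2 ∧ q.2 < p.2) ∧ (p.2 < q.1 ∨ q.1 < p.1)) := by
  simp only [Crosses, strictBtw_iff_of_lt hp, strictBtw_iff_of_gt hp]

/-- every balanced necklace with n red and n blue beads has a proper
homogeneous matching of size at least ⌊n/2⌋. -/
theorem stmt1 (n : ℕ) (hn : 1 ≤ n) (c : Fin (2 * n) → Bool) (hbal : redCount c = n) :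
    ∃ M : Finset (Fin (2 * n) × Fin (2 * n)),
      IsMatching M ∧ IsProper M ∧ Homogeneous c M ∧ n / 2 ≤ M.card := by
  let z : Fin (2 * n) := ⟨0, by omega⟩
  obtain rfl | hn2 : n = 1 ∨ 2 ≤ n := by omega
  · exact ⟨∅, by simp [IsMatching], ⟨by simp [CrossFree], z, 1, by simp [RespectsSecant]⟩,
      by simp [Homogeneous], by simp⟩
  let r := (Finset.univ.filter fun i => c i = true).orderEmbOfFin hbal
  have red (i : Fin n) : c (r i) = true := by
    have := Finset.orderEmbOfFin_mem _ hbal i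
    simpa using this
  let f : Fin (n / 2) → Fin (2 * n) × Fin (2 * n) := fun i =>
    (r ⟨i, by omega⟩, r ⟨n - 1 - i, by omega⟩)
  have f_inj : Function.Injective f := by
    intro i j h
    have := r.injective (congrArg Prod.fst h)
    simpa [Fin.ext_iff] using this
  refine ⟨Finset.univ.map ⟨f, f_inj⟩, ⟨?_, ?_⟩, ⟨?_, z, r ⟨n / 2, by omega⟩, ?_, ?_, ?_⟩, ?_, ?_⟩
  · simp only [Finset.mem_map, Finset.mem_univ, true_and, Function.Embedding.coeFn_mk]
    rintro _ ⟨i, rfl⟩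
    simp only [f, ne_eq, r.injective.eq_iff, Fin.mk.injEq]
    omega
  · simp only [Finset.mem_map, Finset.mem_univ, true_and, Function.Embedding.coeFn_mk]
    rintro _ ⟨i, rfl⟩ _ ⟨j, rfl⟩ hij
    have hij : i.val ≠ j.val := fun h => hij (congrArg f (Fin.ext h))
    simp only [f, ne_eq, r.injective.eq_iff, Fin.mk.injEq]
    omega
  · simp only [CrossFree, Finset.mem_map, Finset.mem_univ, true_and, Function.Embedding.coeFn_mk]
    rintro _ ⟨i, rfl⟩ _ ⟨j, rfl⟩
    have hlt : (f i).1 < (f i).2 := by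
      simp only [f, r.lt_iff_lt, Fin.mk_lt_mk]
      omega
    rw [crosses_iff_of_lt hlt]
    simp only [f, r.lt_iff_lt, Fin.mk_lt_mk]
    omega
  · have : r ⟨0, by omega⟩ < r ⟨n / 2, by omega⟩ := by
      simp only [r.lt_iff_lt, Fin.mk_lt_mk]
      omega
    exact (Nat.zero_le _).trans_lt this
  · exact Fin.is_lt _
  · have inArc (i : Fin n) : InArc z (r ⟨n / 2, by omega⟩) (r i) ↔ i.val < n / 2 := by
      have hz : (r i - z).val = (r i).val := Fin.coe_sub_iff_le.2 (Nat.zero_le _)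
      rw [InArc, hz, ← Fin.lt_def, r.lt_iff_lt, Fin.lt_def]
    simp only [Finset.mem_map, Finset.mem_univ, true_and, Function.Embedding.coeFn_mk]
    rintro _ ⟨i, rfl⟩
    refine Or.inl ⟨(inArc _).2 i.is_lt, fun h => ?_⟩
    have := (inArc ⟨n - 1 - i, by omega⟩).1 h
    dsimp only at this
    omega
  · simp only [Homogeneous, Finset.mem_map, Finset.mem_univ, true_and,
      Function.Embedding.coeFn_mk]
    rintro _ ⟨i, rfl⟩
    simp only [f, red]
  · simp
end

section
/- For every integer s ≥ 2, in the balanced necklace of Construction A with parameter s (which has n = s^{s+1} red and n blue beads), every proper matching — heterogeneous or homogeneous — covers at most 4n/3 + 8s^s beads; in particular, its size is at most 2n/3 + 4s^s. -/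
/-- Construction A with parameter s: n = s^(s+1) red and n blue beads, arranged in
s large arcs; the i-th large arc (0-indexed i₀, so L_{i₀+1}) consists of
2·s^(s-i) monochromatic arcs of length s^i each, colors alternating
red, blue, red, blue, … -/
def constrA (s : ℕ) : Fin (2 * s ^ (s + 1)) → Bool :=
  fun x =>
    let i := x.val / (2 * s ^ s)          -- 0-indexed large arc, i.e. L_{i+1}
    ((x.val % (2 * s ^ s)) / s ^ (i + 1)) % 2 == 0

/-- The (0-indexed) large arc of Construction A containing position `x`. -/
def largeArc (s x : ℕ) : ℕ := x / (2 * s ^ s)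

/-- The length of the monochromatic arcs in the large arc containing position `x`. -/
def runLength (s x : ℕ) : ℕ := s ^ (largeArc s x + 1)

/-- The index, inside its large arc, of the monochromatic arc containing position `x`. -/
def runIndex (s x : ℕ) : ℕ := (x % (2 * s ^ s)) / runLength s x

/-- The color of position `x` in Construction A. -/
def posColor (s x : ℕ) : Bool := runIndex s x % 2 == 0

/-- Two positions lie in the same monochromatic arc. -/
def SameRun (s x y : ℕ) : Prop := largeArc s x = largeArc s y ∧ runIndex s x = runIndex s y

theorem largeArc_mono (s : ℕ) {x y : ℕ} (h : x ≤ y) : largeArc s x ≤ largeArc s y :=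
  Nat.div_le_div_right h

theorem largeArc_lt {s x : ℕ} (hx : x < 2 * s ^ (s + 1)) : largeArc s x < s := by
  refine Nat.div_lt_of_lt_mul ?_
  calc x < 2 * s ^ (s + 1) := hx
    _ = 2 * s ^ s * s := by ring

theorem SameRun.color_eq {s x y : ℕ} (h : SameRun s x y) : posColor s x = posColor s y := by
  simp [posColor, h.2]

theorem SameRun.of_between {s x y z : ℕ} (h : SameRun s x z) (hxy : x ≤ y) (hyz : y ≤ z) :
    SameRun s y z := by
  obtain ⟨h1, h2⟩ := h
  have hl : largeArc s y = largeArc s z :=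
    le_antisymm (largeArc_mono s hyz) (h1 ▸ largeArc_mono s hxy)
  have hmod : ∀ u v : ℕ, largeArc s u = largeArc s v → u ≤ v →
      u % (2 * s ^ s) ≤ v % (2 * s ^ s) := by
    intro u v huv h
    have hu := Nat.div_add_mod u (2 * s ^ s)
    have hv := Nat.div_add_mod v (2 * s ^ s)
    unfold largeArc at huv
    rw [huv] at hu
    omega
  refine ⟨hl, le_antisymm ?_ ?_⟩
  · unfold runIndex runLength
    rw [hl]
    exact Nat.div_le_div_right (hmod _ _ hl hyz)
  · rw [← h2]
    unfold runIndex runLength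
    rw [h1, hl]
    exact Nat.div_le_div_right (hmod _ _ (h1.trans hl.symm) hxy)

theorem runLength_pos {s : ℕ} (hs : 2 ≤ s) (x : ℕ) : 0 < runLength s x :=
  Nat.pow_pos (by omega)

theorem posColor_add_runLength {s x : ℕ} (hs : 2 ≤ s)
    (h : largeArc s (x + runLength s x) = largeArc s x) :
    posColor s (x + runLength s x) ≠ posColor s x := by
  have hr : runIndex s (x + runLength s x) = runIndex s x + 1 := by
    have hmod : (x + runLength s x) % (2 * s ^ s) = x % (2 * s ^ s) + runLength s x := by
      have hu := Nat.div_add_mod x (2 * s ^ s)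
      have hv := Nat.div_add_mod (x + runLength s x) (2 * s ^ s)
      have h' := h
      unfold largeArc at h'
      rw [h'] at hv
      omega
    have hl : runLength s (x + runLength s x) = runLength s x := by
      rw [runLength.eq_def s (x + runLength s x), h, runLength]
    rw [runIndex, hl, hmod, Nat.add_div_right _ (runLength_pos hs x)]
    rfl
  unfold posColor
  rw [hr]
  intro hc
  rw [Bool.eq_iff_iff] at hc
  simp only [beq_iff_eq] at hc
  omega

theorem runIndex_lt {s x : ℕ} (hs : 2 ≤ s) (hx : largeArc s x < s) :
    runIndex s x < 2 * s ^ (s - 1 - largeArc s x) := by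
  refine Nat.div_lt_of_lt_mul ?_
  have hW : 0 < 2 * s ^ s := Nat.mul_pos (by omega) (Nat.pow_pos (by omega))
  calc x % (2 * s ^ s) < 2 * s ^ s := Nat.mod_lt _ hW
    _ = runLength s x * (2 * s ^ (s - 1 - largeArc s x)) := by
      have : s ^ s = s ^ (largeArc s x + 1) * s ^ (s - 1 - largeArc s x) := by
        rw [← pow_add]
        congr 1
        omega
      rw [this, runLength]
      ring

theorem card_le_of_lt_add {S : Finset ℕ} {L : ℕ} (h : ∀ x ∈ S, ∀ y ∈ S, y < x + L) :
    S.card ≤ L := by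
  rcases S.eq_empty_or_nonempty with rfl | hne
  · simp
  · have : S ⊆ Finset.Ico (S.min' hne) (S.min' hne + L) := fun y hy =>
      Finset.mem_Ico.2 ⟨S.min'_le y hy, h _ (S.min'_mem hne) y hy⟩
    simpa using Finset.card_le_card this

theorem card_le_mul_of_fiber {α : Type*} {S : Finset α} {f : α → ℕ} {m k : ℕ}
    (hf : ∀ x ∈ S, f x < m) (hk : ∀ i < m, (S.filter fun x => f x = i).card ≤ k) :
    S.card ≤ k * m := by
  have := Finset.card_le_mul_card_image_of_maps_to (s := S) (t := Finset.range m) (f := f)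
    (fun x hx => Finset.mem_range.2 (hf x hx)) k (fun i hi => hk i (Finset.mem_range.1 hi))
  simpa using this

/-- A family of pairs of positions of Construction A, nested around the cut point `a`, with all
pairs monochromatic or all pairs bichromatic. -/
structure NestedFamily (s a : ℕ) (F : Finset (ℕ × ℕ)) : Prop where
  fst_lt : ∀ p ∈ F, p.1 < a
  le_snd : ∀ p ∈ F, a ≤ p.2
  snd_lt : ∀ p ∈ F, p.2 < 2 * s ^ (s + 1)
  fst_inj : ∀ p ∈ F, ∀ q ∈ F, p.1 = q.1 → p = q
  nested : ∀ p ∈ F, ∀ q ∈ F, p.1 < q.1 → q.2 < p.2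
  color : ∃ e : Bool, ∀ p ∈ F, (posColor s p.1 == posColor s p.2) = e

/-- The left endpoint of `p` cannot be shifted by one run to a position of the same large arc, left
of the cut `a` and not a left endpoint of `F`. -/
def Blocked (s a : ℕ) (F : Finset (ℕ × ℕ)) (p : ℕ × ℕ) : Prop :=
  largeArc s (p.1 + runLength s p.1) ≠ largeArc s p.1 ∨ a ≤ p.1 + runLength s p.1 ∨
    ∃ q ∈ F, q.1 = p.1 + runLength s p.1

namespace NestedFamily

variable {s a : ℕ} {F : Finset (ℕ × ℕ)}

theorem snd_le (hF : NestedFamily s a F) {p q : ℕ × ℕ} (hp : p ∈ F) (hq : q ∈ F)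
    (h : p.1 ≤ q.1) : q.2 ≤ p.2 := by
  rcases h.lt_or_eq with h | h
  · exact (hF.nested p hp q hq h).le
  · rw [hF.fst_inj p hp q hq h]

theorem fst_lt_of_blocked (hF : NestedFamily s a F) (hs : 2 ≤ s) {p q : ℕ × ℕ} (hp : p ∈ F)
    (hq : q ∈ F) (hb : Blocked s a F p) (hl : largeArc s p.1 = largeArc s q.1)
    (hr : SameRun s p.2 q.2) : q.1 < p.1 + runLength s p.1 := by
  by_contra! hle
  have hsame : largeArc s (p.1 + runLength s p.1) = largeArc s p.1 :=
    le_antisymm (hl ▸ largeArc_mono s hle) (largeArc_mono s (by omega))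
  rcases hb with h | h | ⟨r, hrF, h⟩
  · exact h hsame
  · have := hF.fst_lt q hq
    omega
  · have hpos := runLength_pos hs p.1
    have h1 := hF.snd_le hp hrF (by omega)
    have h2 := hF.snd_le hrF hq (by omega)
    have hc := (SameRun.of_between ⟨hr.1.symm, hr.2.symm⟩ h2 h1).color_eq
    have hne := posColor_add_runLength hs hsame
    obtain ⟨e, he⟩ := hF.color
    have e1 := he p hp
    have e2 := he r hrF
    rw [hc, h] at e2
    revert hne e1 e2
    cases posColor s (p.1 + runLength s p.1) <;> cases posColor s p.1 <;>
      cases posColor s p.2 <;> cases e <;> simp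

theorem card_fst_le (hF : NestedFamily s a F) {S : Finset (ℕ × ℕ)} (hS : S ⊆ F) {L : ℕ}
    (h : ∀ p ∈ S, ∀ q ∈ S, q.1 < p.1 + L) : S.card ≤ L := by
  have hinj : Set.InjOn Prod.fst (S : Set (ℕ × ℕ)) := fun p hp q hq =>
    hF.fst_inj p (hS hp) q (hS hq)
  rw [← Finset.card_image_of_injOn hinj]
  refine card_le_of_lt_add ?_
  simp only [Finset.mem_image]
  rintro _ ⟨p, hp, rfl⟩ _ ⟨q, hq, rfl⟩
  exact h p hp q hq

theorem card_blocked_group_le (hF : NestedFamily s a F) (hs : 2 ≤ s) {S : Finset (ℕ × ℕ)}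
    (hS : S ⊆ F) {i : ℕ} (hb : ∀ p ∈ S, Blocked s a F p) (hl : ∀ p ∈ S, largeArc s p.1 = i)
    (hr : ∀ p ∈ S, ∀ q ∈ S, SameRun s p.2 q.2) : S.card ≤ s ^ (i + 1) := by
  refine hF.card_fst_le hS fun p hp q hq => ?_
  have := hF.fst_lt_of_blocked hs (hS hp) (hS hq) (hb p hp) ((hl p hp).trans (hl q hq).symm)
    (hr p hp q hq)
  rwa [runLength, hl p hp] at this

theorem card_same_largeArc_le (hF : NestedFamily s a F) :
    (F.filter fun p => largeArc s p.1 = largeArc s p.2).card ≤ 2 * s ^ s := by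
  refine hF.card_fst_le (Finset.filter_subset _ _) fun p hp q hq => ?_
  rw [Finset.mem_filter] at hp hq
  have key : ∀ p ∈ F, largeArc s p.1 = largeArc s p.2 → largeArc s p.1 = largeArc s a := by
    intro p hp h
    exact le_antisymm (largeArc_mono s (hF.fst_lt p hp).le)
      (h ▸ largeArc_mono s (hF.le_snd p hp))
  have h := (key p hp.1 hp.2).trans (key q hq.1 hq.2).symm
  unfold largeArc at h
  have hu := Nat.div_add_mod p.1 (2 * s ^ s)
  have hv := Nat.div_add_mod q.1 (2 * s ^ s)
  rw [h] at hu
  rcases Nat.eq_zero_or_pos s with rfl | hs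
  · have := hF.snd_lt p hp.1
    simp at this
  · have := Nat.mod_lt q.1 (y := 2 * s ^ s) (Nat.mul_pos (by omega) (Nat.pow_pos hs))
    omega

/-- Some pair of `F` ends in the same run as `p` but starts in a later large arc. -/
def Later (s : ℕ) (F : Finset (ℕ × ℕ)) (p : ℕ × ℕ) : Prop :=
  ∃ q ∈ F, SameRun s q.2 p.2 ∧ largeArc s p.1 < largeArc s q.1

theorem largeArc_fst_le (hF : NestedFamily s a F) {p : ℕ × ℕ} (hp : p ∈ F) :
    largeArc s p.1 ≤ largeArc s p.2 :=
  largeArc_mono s ((hF.fst_lt p hp).le.trans (hF.le_snd p hp))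

theorem card_later_le (hF : NestedFamily s a F) (hs : 2 ≤ s) {S : Finset (ℕ × ℕ)}
    (hS : S ⊆ F) (hb : ∀ p ∈ S, Blocked s a F p) (hne : ∀ p ∈ S, largeArc s p.1 ≠ largeArc s p.2)
    (hlat : ∀ p ∈ S, Later s F p) : S.card ≤ s ^ s := by
  have hlt : ∀ p ∈ S, largeArc s p.1 < largeArc s p.2 := fun p hp =>
    lt_of_le_of_ne (hF.largeArc_fst_le (hS hp)) (hne p hp)
  have hlts : ∀ p ∈ S, largeArc s p.2 < s := fun p hp => largeArc_lt (hF.snd_lt p (hS hp))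
  have hsame : ∀ p ∈ S, ∀ q ∈ S, largeArc s p.1 = largeArc s q.1 → p.2 ≤ q.2 →
      SameRun s p.2 q.2 := by
    intro p hp q hq hpq hle
    obtain ⟨r, hrF, hr, hl⟩ := hlat q hq
    rcases le_or_gt r.2 p.2 with h | h
    · exact hr.of_between h hle
    · have : r.1 ≤ p.1 := by
        by_contra! hc
        have := hF.nested p (hS hp) r hrF hc
        omega
      have := largeArc_mono s this
      omega
  have hpow : s ^ (s - 1) * s = s ^ s := by
    rw [← pow_succ]
    congr 1
    omega
  rw [← hpow]
  refine card_le_mul_of_fiber (f := fun p => largeArc s p.1)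
    (fun p hp => (hlt p hp).trans (hlts p hp)) fun i _ => ?_
  rcases (S.filter fun p => largeArc s p.1 = i).eq_empty_or_nonempty with h0 | ⟨x, hx⟩
  · rw [h0]
    simp
  · have hi : i + 1 ≤ s - 1 := by
      rw [Finset.mem_filter] at hx
      have h1 := hlt x hx.1
      have h2 := hlts x hx.1
      omega
    refine le_trans (hF.card_blocked_group_le hs (i := i)
      ((Finset.filter_subset _ _).trans hS) ?_ ?_ ?_) (Nat.pow_le_pow_right (by omega) hi)
    · exact fun p hp => hb p (Finset.mem_filter.1 hp).1
    · exact fun p hp => (Finset.mem_filter.1 hp).2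
    · intro p hp q hq
      rw [Finset.mem_filter] at hp hq
      rcases le_total p.2 q.2 with h | h
      · exact hsame p hp.1 q hq.1 (hp.2.trans hq.2.symm) h
      · have := hsame q hq.1 p hp.1 (hq.2.trans hp.2.symm) h
        exact ⟨this.1.symm, this.2.symm⟩

theorem card_not_later_le (hF : NestedFamily s a F) (hs : 2 ≤ s) {S : Finset (ℕ × ℕ)}
    (hS : S ⊆ F) (hb : ∀ p ∈ S, Blocked s a F p) (hne : ∀ p ∈ S, largeArc s p.1 ≠ largeArc s p.2)
    (hlat : ∀ p ∈ S, ¬ Later s F p) : S.card ≤ 2 * s ^ s := by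
  have hlt : ∀ p ∈ S, largeArc s p.1 < largeArc s p.2 := fun p hp =>
    lt_of_le_of_ne (hF.largeArc_fst_le (hS hp)) (hne p hp)
  have hlts : ∀ p ∈ S, largeArc s p.2 < s := fun p hp => largeArc_lt (hF.snd_lt p (hS hp))
  have hle : ∀ p ∈ S, ∀ q ∈ S, SameRun s p.2 q.2 → largeArc s p.1 ≤ largeArc s q.1 := by
    intro p hp q hq h
    by_contra! hc
    exact hlat q hq ⟨p, hS hp, h, hc⟩
  have hpow : 2 * s ^ s = 2 * s ^ (s - 1) * s := by
    rw [mul_assoc, ← pow_succ]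
    congr 2
    omega
  rw [hpow]
  refine card_le_mul_of_fiber (f := fun p => largeArc s p.2) hlts fun j hj => ?_
  have hpow' : 2 * s ^ (s - 1) = s ^ j * (2 * s ^ (s - 1 - j)) := by
    rw [mul_left_comm, ← pow_add]
    congr 2
    omega
  rw [hpow']
  refine card_le_mul_of_fiber (f := fun p => runIndex s p.2) ?_ fun r _ => ?_
  · intro p hp
    rw [Finset.mem_filter] at hp
    have := runIndex_lt hs (hlts p hp.1)
    rwa [hp.2] at this
  · set T := (S.filter fun p => largeArc s p.2 = j).filter fun p => runIndex s p.2 = r with hT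
    have hmem : ∀ p ∈ T, p ∈ S ∧ largeArc s p.2 = j ∧ runIndex s p.2 = r := by
      intro p hp
      simpa [hT, and_assoc] using hp
    have hrun : ∀ p ∈ T, ∀ q ∈ T, SameRun s p.2 q.2 := fun p hp q hq =>
      ⟨(hmem p hp).2.1.trans (hmem q hq).2.1.symm, (hmem p hp).2.2.trans (hmem q hq).2.2.symm⟩
    rcases T.eq_empty_or_nonempty with h0 | ⟨x, hx⟩
    · rw [h0]
      simp
    · have hi : largeArc s x.1 + 1 ≤ j := by
        have := hlt x (hmem x hx).1
        rw [(hmem x hx).2.1] at this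
        exact this
      refine le_trans (hF.card_blocked_group_le hs (i := largeArc s x.1)
        (fun p hp => hS (hmem p hp).1) (fun p hp => hb p (hmem p hp).1) ?_ hrun)
        (Nat.pow_le_pow_right (by omega) hi)
      exact fun p hp => le_antisymm (hle p (hmem p hp).1 x (hmem x hx).1 (hrun p hp x hx))
        (hle x (hmem x hx).1 p (hmem p hp).1 (hrun x hx p hp))

open Classical in
theorem card_blocked_le (hF : NestedFamily s a F) (hs : 2 ≤ s) :
    (F.filter (Blocked s a F)).card ≤ 5 * s ^ s := by
  set B := F.filter (Blocked s a F) with hB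
  set E := B.filter fun p => ¬ largeArc s p.1 = largeArc s p.2 with hE
  have h1 : (B.filter fun p => largeArc s p.1 = largeArc s p.2).card ≤ 2 * s ^ s :=
    le_trans (Finset.card_le_card (Finset.filter_subset_filter _ (Finset.filter_subset _ _)))
      hF.card_same_largeArc_le
  have h2 : (E.filter (Later s F)).card ≤ s ^ s := by
    refine hF.card_later_le hs ?_ ?_ ?_ ?_ <;> intro p hp <;>
      simp only [hE, hB, Finset.mem_filter] at hp
    exacts [hp.1.1.1, hp.1.1.2, hp.1.2, hp.2]
  have h3 : (E.filter fun p => ¬ Later s F p).card ≤ 2 * s ^ s := by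
    refine hF.card_not_later_le hs ?_ ?_ ?_ ?_ <;> intro p hp <;>
      simp only [hE, hB, Finset.mem_filter] at hp
    exacts [hp.1.1.1, hp.1.1.2, hp.1.2, hp.2]
  have e1 := Finset.card_filter_add_card_filter_not (s := B)
    fun p => largeArc s p.1 = largeArc s p.2
  rw [← hE] at e1
  have e2 := Finset.card_filter_add_card_filter_not (s := E) (Later s F)
  omega

/-- All but few pairs of a nested family can be charged to positions that are not left endpoints. -/
theorem exists_free (hF : NestedFamily s a F) (hs : 2 ≤ s) :
    ∃ G : Finset ℕ, F.card ≤ G.card + 5 * s ^ s ∧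
      ∀ x ∈ G, x < a ∧ (∃ p ∈ F, p.1 < x) ∧ ∀ p ∈ F, p.1 ≠ x := by
  classical
  set f : ℕ × ℕ → ℕ := fun p => p.1 + runLength s p.1 with hf
  set U := F.filter fun p => ¬ Blocked s a F p with hU
  have hmem : ∀ p ∈ U, p ∈ F ∧ largeArc s (f p) = largeArc s p.1 ∧ f p < a ∧
      ∀ q ∈ F, q.1 ≠ f p := by
    intro p hp
    rw [hU, Finset.mem_filter, Blocked] at hp
    push Not at hp
    exact hp
  have hinj : Set.InjOn f (U : Set (ℕ × ℕ)) := by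
    intro p hp q hq hpq
    have h1 := hmem p hp
    have h2 := hmem q hq
    have hl : largeArc s p.1 = largeArc s q.1 := by
      rw [← h1.2.1, ← h2.2.1, hpq]
    refine hF.fst_inj p h1.1 q h2.1 ?_
    simp only [hf, runLength, hl] at hpq
    omega
  refine ⟨U.image f, ?_, ?_⟩
  · rw [Finset.card_image_of_injOn hinj]
    have e := Finset.card_filter_add_card_filter_not (s := F) (Blocked s a F)
    rw [← hU] at e
    have := hF.card_blocked_le hs
    omega
  · intro x hx
    obtain ⟨p, hp, rfl⟩ := Finset.mem_image.1 hx
    obtain ⟨h1, -, h3, h4⟩ := hmem p hp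
    have := runLength_pos hs p.1
    exact ⟨h3, ⟨p, h1, by simp only [hf]; omega⟩, h4⟩

end NestedFamily

/-- A linear version of the bound: pairs of positions, with exactly one member of each pair in
the interval `[a, b)`. -/
theorem three_mul_card_le {s a b : ℕ} (hs : 2 ≤ s) {P : Finset (ℕ × ℕ)}
    (hlt : ∀ p ∈ P, p.1 < p.2) (hN : ∀ p ∈ P, p.2 < 2 * s ^ (s + 1))
    (hdisj : ∀ p ∈ P, ∀ q ∈ P, p ≠ q → p.1 ≠ q.1 ∧ p.1 ≠ q.2 ∧ p.2 ≠ q.1 ∧ p.2 ≠ q.2)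
    (hcross : ∀ p ∈ P, ∀ q ∈ P, ¬ (p.1 < q.1 ∧ q.1 < p.2 ∧ p.2 < q.2))
    (hsec : ∀ p ∈ P, Xor (a ≤ p.1 ∧ p.1 < b) (a ≤ p.2 ∧ p.2 < b))
    (hcol : ∃ e : Bool, ∀ p ∈ P, (posColor s p.1 == posColor s p.2) = e) :
    3 * P.card ≤ 2 * s ^ (s + 1) + 10 * s ^ s := by
  set F₁ := P.filter fun p => p.1 < a with hF₁
  set F₂ := P.filter fun p => ¬ p.1 < a with hF₂
  have m₁ : ∀ p ∈ F₁, p ∈ P ∧ p.1 < a ∧ a ≤ p.2 ∧ p.2 < b := by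
    intro p hp
    rw [hF₁, Finset.mem_filter] at hp
    have h1 := hlt p hp.1
    have h2 := hsec p hp.1
    unfold Xor at h2
    refine ⟨hp.1, hp.2, ?_⟩
    omega
  have m₂ : ∀ p ∈ F₂, p ∈ P ∧ a ≤ p.1 ∧ p.1 < b ∧ b ≤ p.2 := by
    intro p hp
    rw [hF₂, Finset.mem_filter] at hp
    have h1 := hlt p hp.1
    have h2 := hsec p hp.1
    unfold Xor at h2
    refine ⟨hp.1, ?_⟩
    omega
  have hinj : ∀ p ∈ P, ∀ q ∈ P, p.1 = q.1 → p = q := by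
    intro p hp q hq h
    by_contra hne
    exact (hdisj p hp q hq hne).1 h
  have hnest : ∀ p ∈ P, ∀ q ∈ P, p.1 < q.1 → q.1 < p.2 → q.2 < p.2 := by
    intro p hp q hq h h'
    have hne : p ≠ q := by
      rintro rfl
      omega
    have h1 := (hdisj p hp q hq hne).2.2.2
    have h2 := hcross p hp q hq
    omega
  obtain ⟨e, he⟩ := hcol
  have N₁ : NestedFamily s a F₁ :=
    { fst_lt := fun p hp => (m₁ p hp).2.1
      le_snd := fun p hp => (m₁ p hp).2.2.1
      snd_lt := fun p hp => hN p (m₁ p hp).1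
      fst_inj := fun p hp q hq => hinj p (m₁ p hp).1 q (m₁ q hq).1
      nested := fun p hp q hq h => hnest p (m₁ p hp).1 q (m₁ q hq).1 h
        ((m₁ q hq).2.1.trans_le (m₁ p hp).2.2.1)
      color := ⟨e, fun p hp => he p (m₁ p hp).1⟩ }
  have N₂ : NestedFamily s b F₂ :=
    { fst_lt := fun p hp => (m₂ p hp).2.2.1
      le_snd := fun p hp => (m₂ p hp).2.2.2
      snd_lt := fun p hp => hN p (m₂ p hp).1
      fst_inj := fun p hp q hq => hinj p (m₂ p hp).1 q (m₂ q hq).1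
      nested := fun p hp q hq h => hnest p (m₂ p hp).1 q (m₂ q hq).1 h
        ((m₂ q hq).2.2.1.trans_le (m₂ p hp).2.2.2)
      color := ⟨e, fun p hp => he p (m₂ p hp).1⟩ }
  obtain ⟨G₁, c₁, g₁⟩ := N₁.exists_free hs
  obtain ⟨G₂, c₂, g₂⟩ := N₂.exists_free hs
  have hsplit : F₁.card + F₂.card = P.card :=
    Finset.card_filter_add_card_filter_not _
  have hG : Disjoint G₁ G₂ := by
    rw [Finset.disjoint_left]
    intro x h1 h2
    obtain ⟨h, -⟩ := g₁ x h1
    obtain ⟨-, ⟨p, hp, hpx⟩, -⟩ := g₂ x h2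
    have := (m₂ p hp).2.1
    omega
  have hmemP : ∀ p ∈ P, p ∈ F₁ ∨ p ∈ F₂ := by
    intro p hp
    by_cases h : p.1 < a
    · exact Or.inl (Finset.mem_filter.2 ⟨hp, h⟩)
    · exact Or.inr (Finset.mem_filter.2 ⟨hp, h⟩)
  have hfree : ∀ x ∈ G₁ ∪ G₂, ∀ p ∈ P, p.1 ≠ x ∧ p.2 ≠ x := by
    intro x hx p hp
    rcases Finset.mem_union.1 hx with hx | hx
    · obtain ⟨h1, -, h3⟩ := g₁ x hx
      rcases hmemP p hp with h | h
      · have := m₁ p h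
        exact ⟨h3 p h, by omega⟩
      · have := m₂ p h
        have := hlt p hp
        omega
    · obtain ⟨h1, ⟨q, hq, hqx⟩, h3⟩ := g₂ x hx
      have hq' := m₂ q hq
      rcases hmemP p hp with h | h
      · have hp' := m₁ p h
        refine ⟨by omega, fun hpx => ?_⟩
        exact hcross p hp q hq'.1 ⟨by omega, by omega, by omega⟩
      · have := m₂ p h
        exact ⟨h3 p h, by omega⟩
  have hfst : (P.image Prod.fst).card = P.card :=
    Finset.card_image_of_injOn fun p hp q hq h => hinj p hp q hq h
  have hsnd : (P.image Prod.snd).card = P.card := by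
    refine Finset.card_image_of_injOn fun p hp q hq h => ?_
    by_contra hne
    exact (hdisj p hp q hq hne).2.2.2 h
  have d1 : Disjoint (P.image Prod.fst) (P.image Prod.snd) := by
    rw [Finset.disjoint_left]
    simp only [Finset.mem_image]
    rintro _ ⟨p, hp, rfl⟩ ⟨q, hq, h⟩
    by_cases hpq : p = q
    · subst hpq
      have := hlt p hp
      omega
    · exact (hdisj p hp q hq hpq).2.1 h.symm
  have d2 : Disjoint (P.image Prod.fst ∪ P.image Prod.snd) (G₁ ∪ G₂) := by
    rw [Finset.disjoint_right]
    intro x hx h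
    simp only [Finset.mem_union, Finset.mem_image] at h
    rcases h with ⟨p, hp, h⟩ | ⟨p, hp, h⟩
    · exact (hfree x hx p hp).1 h
    · exact (hfree x hx p hp).2 h
  have hsub : (P.image Prod.fst ∪ P.image Prod.snd) ∪ (G₁ ∪ G₂) ⊆
      Finset.range (2 * s ^ (s + 1)) := by
    intro x hx
    rw [Finset.mem_range]
    simp only [Finset.mem_union, Finset.mem_image] at hx
    rcases hx with (⟨p, hp, rfl⟩ | ⟨p, hp, rfl⟩) | hx | hx
    · exact (hlt p hp).trans (hN p hp)
    · exact hN p hp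
    · obtain ⟨h1, ⟨q, hq, -⟩, -⟩ := g₁ x hx
      exact h1.trans_le ((m₁ q hq).2.2.1.trans (hN q (m₁ q hq).1).le)
    · obtain ⟨h1, ⟨q, hq, -⟩, -⟩ := g₂ x hx
      exact h1.trans_le ((m₂ q hq).2.2.2.trans (hN q (m₂ q hq).1).le)
  have hcard := Finset.card_le_card hsub
  rw [Finset.card_union_of_disjoint d2, Finset.card_union_of_disjoint d1,
    Finset.card_union_of_disjoint hG, hfst, hsnd, Finset.card_range] at hcard
  omega

theorem Fin.val_sub_cases {N : ℕ} (x k : Fin N) :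
    (k.val ≤ x.val ∧ (x - k).val = x.val - k.val) ∨
      (x.val < k.val ∧ (x - k).val = N + x.val - k.val) := by
  rcases le_or_gt k x with h | h
  · exact Or.inl ⟨h, Fin.sub_val_of_le h⟩
  · exact Or.inr ⟨h, Fin.coe_sub_iff_lt.2 h⟩

theorem crosses_swap_left {N : ℕ} (p q : Fin N × Fin N) : Crosses p.swap q ↔ Crosses p q := by
  simp only [Crosses, Prod.fst_swap, Prod.snd_swap]
  tauto

theorem crosses_swap_right {N : ℕ} (p q : Fin N × Fin N) : Crosses p q.swap ↔ Crosses p q := by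
  simp only [Crosses, Prod.fst_swap, Prod.snd_swap]
  tauto

theorem crosses_of_lt {N : ℕ} {p q : Fin N × Fin N} (h1 : p.1.val < q.1.val)
    (h2 : q.1.val < p.2.val) (h3 : p.2.val < q.2.val) : Crosses p q := by
  left
  have a1 := Fin.val_sub_cases q.1 p.1
  have a2 := Fin.val_sub_cases p.2 p.1
  have a3 := Fin.val_sub_cases q.2 p.2
  have a4 := Fin.val_sub_cases p.1 p.2
  have := q.2.isLt
  unfold strictBtw
  omega

theorem exists_interval_of_respectsSecant {N : ℕ} {M : Finset (Fin N × Fin N)} {k : Fin N} {m : ℕ}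
    (h : RespectsSecant M k m) :
    ∃ a b : ℕ, ∀ p ∈ M, Xor (a ≤ p.1.val ∧ p.1.val < b) (a ≤ p.2.val ∧ p.2.val < b) := by
  obtain ⟨h0, hm, h⟩ := h
  rcases le_or_gt (k.val + m) N with hk | hk
  · refine ⟨k.val, k.val + m, fun p hp => ?_⟩
    have hx : Xor (InArc k m p.1) (InArc k m p.2) := h p hp
    have a1 := Fin.val_sub_cases p.1 k
    have a2 := Fin.val_sub_cases p.2 k
    unfold Xor InArc at hx
    unfold Xor
    omega
  · refine ⟨k.val + m - N, k.val, fun p hp => ?_⟩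
    have hx : Xor (InArc k m p.1) (InArc k m p.2) := h p hp
    have a1 := Fin.val_sub_cases p.1 k
    have a2 := Fin.val_sub_cases p.2 k
    have := p.1.isLt
    have := p.2.isLt
    unfold Xor InArc at hx
    unfold Xor
    omega

/-- The positions of a pair of beads, in increasing order. -/
def sortedPair {N : ℕ} (p : Fin N × Fin N) : ℕ × ℕ :=
  if p.1.val ≤ p.2.val then (p.1.val, p.2.val) else (p.2.val, p.1.val)

theorem sortedPair_cases {N : ℕ} (p : Fin N × Fin N) :
    ∃ p' : Fin N × Fin N, (p' = p ∨ p' = p.swap) ∧ sortedPair p = (p'.1.val, p'.2.val) ∧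
      p'.1.val ≤ p'.2.val := by
  unfold sortedPair
  split_ifs with h
  · exact ⟨p, Or.inl rfl, rfl, h⟩
  · exact ⟨p.swap, Or.inr rfl, rfl, by simp only [Prod.fst_swap, Prod.snd_swap]; omega⟩

theorem IsMatching.sortedPair_disjoint {N : ℕ} {M : Finset (Fin N × Fin N)} (hM : IsMatching M)
    {p q : Fin N × Fin N} (hp : p ∈ M) (hq : q ∈ M) (hne : p ≠ q) :
    (sortedPair p).1 ≠ (sortedPair q).1 ∧ (sortedPair p).1 ≠ (sortedPair q).2 ∧
      (sortedPair p).2 ≠ (sortedPair q).1 ∧ (sortedPair p).2 ≠ (sortedPair q).2 := by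
  have h := hM.2 p hp q hq hne
  simp only [ne_eq, Fin.ext_iff] at h
  unfold sortedPair
  split_ifs <;> dsimp only <;> omega

theorem three_mul_card_proper_le {s : ℕ} (hs : 2 ≤ s)
    {M : Finset (Fin (2 * s ^ (s + 1)) × Fin (2 * s ^ (s + 1)))}
    (hM : IsMatching M) (hproper : IsProper M)
    (hcol : Heterogeneous (constrA s) M ∨ Homogeneous (constrA s) M) :
    3 * M.card ≤ 2 * s ^ (s + 1) + 10 * s ^ s := by
  obtain ⟨hcf, k, m, hsec⟩ := hproper
  obtain ⟨a, b, hab⟩ := exists_interval_of_respectsSecant hsec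
  have hinj : Set.InjOn sortedPair
      (M : Set (Fin (2 * s ^ (s + 1)) × Fin (2 * s ^ (s + 1)))) := by
    intro p hp q hq h
    by_contra hne
    exact (hM.sortedPair_disjoint hp hq hne).1 (by rw [h])
  rw [← Finset.card_image_of_injOn hinj]
  refine three_mul_card_le (a := a) (b := b) hs ?_ ?_ ?_ ?_ ?_ ?_
  · simp only [Finset.mem_image]
    rintro _ ⟨p, hp, rfl⟩
    have := hM.1 p hp
    rw [ne_eq, Fin.ext_iff] at this
    unfold sortedPair
    split_ifs <;> dsimp only <;> omega
  · simp only [Finset.mem_image]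
    rintro _ ⟨p, hp, rfl⟩
    obtain ⟨p', -, h, -⟩ := sortedPair_cases p
    rw [h]
    exact p'.2.isLt
  · simp only [Finset.mem_image]
    rintro _ ⟨p, hp, rfl⟩ _ ⟨q, hq, rfl⟩ hne
    exact hM.sortedPair_disjoint hp hq fun h => hne (by rw [h])
  · simp only [Finset.mem_image]
    rintro _ ⟨p, hp, rfl⟩ _ ⟨q, hq, rfl⟩ ⟨h1, h2, h3⟩
    obtain ⟨p', hp', ep, -⟩ := sortedPair_cases p
    obtain ⟨q', hq', eq, -⟩ := sortedPair_cases q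
    rw [ep, eq] at h1 h2
    rw [ep, eq] at h3
    have hc : Crosses p' q' := crosses_of_lt h1 h2 h3
    refine hcf p hp q hq ?_
    rcases hp' with rfl | rfl <;> rcases hq' with rfl | rfl <;>
      simpa only [crosses_swap_left, crosses_swap_right] using hc
  · simp only [Finset.mem_image]
    rintro _ ⟨p, hp, rfl⟩
    have := hab p hp
    unfold sortedPair
    split_ifs
    · exact this
    · exact (xor_comm _ _).mp this
  · have hpos : ∀ p : Fin (2 * s ^ (s + 1)) × Fin (2 * s ^ (s + 1)),
        (posColor s (sortedPair p).1 == posColor s (sortedPair p).2) =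
          (constrA s p.1 == constrA s p.2) := by
      intro p
      unfold sortedPair
      split_ifs
      · rfl
      · exact Bool.beq_comm
    simp only [Finset.mem_image]
    rcases hcol with h | h
    · refine ⟨false, ?_⟩
      rintro _ ⟨p, hp, rfl⟩
      rw [hpos]
      exact beq_false_of_ne (h p hp)
    · refine ⟨true, ?_⟩
      rintro _ ⟨p, hp, rfl⟩
      rw [hpos]
      exact beq_iff_eq.2 (h p hp)

/-- in Construction A every proper matching (heterogeneous or
homogeneous) covers at most 4n/3 + 8s^s beads; in particular its size is at
most 2n/3 + 4s^s, where n = s^(s+1). -/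
theorem stmt4 (s : ℕ) (hs : 2 ≤ s)
    (M : Finset (Fin (2 * s ^ (s + 1)) × Fin (2 * s ^ (s + 1))))
    (hM : IsMatching M) (hproper : IsProper M)
    (hcol : Heterogeneous (constrA s) M ∨ Homogeneous (constrA s) M) :
    (2 * M.card : ℝ) ≤ 4 * (s : ℝ) ^ (s + 1) / 3 + 8 * (s : ℝ) ^ s ∧
    (M.card : ℝ) ≤ 2 * (s : ℝ) ^ (s + 1) / 3 + 4 * (s : ℝ) ^ s := by
  have h : (3 * M.card : ℝ) ≤ 2 * (s : ℝ) ^ (s + 1) + 10 * (s : ℝ) ^ s := by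
    exact_mod_cast three_mul_card_proper_le hs hM hproper hcol
  have hpos : (0 : ℝ) ≤ (s : ℝ) ^ s := by positivity
  constructor <;> linarith
end

section
/- For every ε > 0 and every N₀, there exist an even integer N ≥ N₀, with N = 2n, and a balanced necklace L with n red and n blue beads, such that mono(L) ≤ ε·N and every proper heterogeneous matching of L has size at most (2 − √2 + ε)·n (equivalently, covers at most (2 − √2 + ε)·N beads). -/
open Finset in
theorem card_filter_Ico_mul_of_periodic {pr : ℕ → Prop} [DecidablePred pr] {T k : ℕ}
    (hper : Function.Periodic pr T) (hk : T.count pr = k) (m c : ℕ) :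
    ((Ico c (c + T * m)).filter pr).card = k * m := by
  induction m generalizing c with
  | zero => simp
  | succ m ih =>
    have h1 : Ico c (c + T * (m + 1)) = Ico c (c + T * m) ∪ Ico (c + T * m) (c + T * m + T) := by
      rw [Ico_union_Ico_eq_Ico (by omega) (by omega)]; congr 1; ring
    rw [h1, filter_union, card_union_of_disjoint, ih,
      Nat.filter_Ico_card_eq_of_periodic _ _ _ hper, hk]
    · ring
    · exact disjoint_filter_filter (Ico_disjoint_Ico_consecutive _ _ _)

open Finset in
theorem card_filter_Ico_le_of_periodic {pr : ℕ → Prop} [DecidablePred pr] {T k : ℕ} (hT : 0 < T)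
    (hper : Function.Periodic pr T) (hk : T.count pr = k) (a b : ℕ) (hab : a ≤ b) :
    (((Ico a b).filter pr).card : ℝ) ≤ (k / T : ℝ) * (b - a) + k := by
  have h2 : ((Ico a b).filter pr).card ≤ k * ((b - a) / T + 1) := by
    rw [← card_filter_Ico_mul_of_periodic hper hk _ a]
    refine card_le_card (filter_subset_filter _ (Ico_subset_Ico_right ?_))
    have := Nat.lt_mul_div_succ (b - a) hT
    omega
  have h3 : (((b - a) / T : ℕ) : ℝ) ≤ ((b : ℝ) - a) / T := by
    have := @Nat.cast_div_le ℝ _ _ _ (b - a) T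
    rwa [Nat.cast_sub hab] at this
  calc (((Ico a b).filter pr).card : ℝ) ≤ k * (((b - a) / T : ℕ) + 1) := by exact_mod_cast h2
    _ ≤ k * (((b : ℝ) - a) / T + 1) := by gcongr
    _ = _ := by ring

theorem count_div_mod_lt (e h g : ℕ) (he : 0 < e) (hg : g ≤ h) :
    (h * e).count (fun z => z / e % h < g) = g * e := by
  rw [Nat.count_eq_card_filter_range]
  have : (Finset.range (h * e)).filter (fun z => z / e % h < g) = Finset.range (g * e) := by
    ext z
    simp only [Finset.mem_filter, Finset.mem_range]
    constructor
    · rintro ⟨h1, h2⟩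
      rw [Nat.mod_eq_of_lt ((Nat.div_lt_iff_lt_mul he).2 h1)] at h2
      exact (Nat.div_lt_iff_lt_mul he).1 h2
    · intro h1
      have h2 : z < h * e := h1.trans_le (Nat.mul_le_mul_right _ hg)
      refine ⟨h2, ?_⟩
      rw [Nat.mod_eq_of_lt ((Nat.div_lt_iff_lt_mul he).2 h2)]
      exact (Nat.div_lt_iff_lt_mul he).2 h1
  rw [this, Finset.card_range]

theorem periodic_div_mod_lt (e h g : ℕ) (he : 0 < e) :
    Function.Periodic (fun z => z / e % h < g) (h * e) := by
  intro z
  simp [Nat.add_mul_div_right _ _ he]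

/-- Runs of `B * e` beads whose majority colour alternates; inside a run, each period of `h * e`
beads has `g * e` consecutive beads of the majority colour and then the rest of the other one. -/
def layerWord (e B h g z : ℕ) : Bool :=
  decide (z / e / B % 2 = 0) == decide (z / e % h < g)

theorem layerWord_add_half {e B h : ℕ} (g : ℕ) (he : 0 < e) (hB : 0 < B) (hd : h ∣ B) (z : ℕ) :
    layerWord e B h g (z + B * e) = !layerWord e B h g z := by
  obtain ⟨q, rfl⟩ := hd
  unfold layerWord
  rw [Nat.add_mul_div_right _ _ he, Nat.add_div_right _ hB, Nat.add_mul_mod_self_left]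
  rcases Nat.mod_two_eq_zero_or_one (z / e / (h * q)) with h0 | h0 <;>
    simp [Nat.add_mod, h0]

theorem layerWord_periodic {e B h : ℕ} (g : ℕ) (he : 0 < e) (hB : 0 < B) (hd : h ∣ B) :
    Function.Periodic (layerWord e B h g) (2 * (B * e)) := by
  intro z
  rw [two_mul, ← add_assoc, layerWord_add_half g he hB hd, layerWord_add_half g he hB hd,
    Bool.not_not]

theorem count_layerWord {e B h : ℕ} (g : ℕ) (he : 0 < e) (hB : 0 < B) (hd : h ∣ B) (x : Bool) :
    (2 * (B * e)).count (fun z => layerWord e B h g z = x) = B * e := by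
  rw [two_mul, Nat.count_add]
  have : (fun k => layerWord e B h g (B * e + k) = x) = fun k => ¬ layerWord e B h g k = x := by
    ext k
    rw [add_comm, layerWord_add_half g he hB hd]
    cases layerWord e B h g k <;> cases x <;> simp
  simp only [this, Nat.count_eq_card_filter_range]
  rw [Finset.card_filter_add_card_filter_not]
  simp

/-- A nested family of pairs with first entries in `[a, a')`, second entries in `[b, b')`, and
related by `R`. -/
structure IsFold (R : ℕ → ℕ → Prop) (P : Finset (ℕ × ℕ)) (a a' b b' : ℕ) : Prop where
  mem : ∀ x ∈ P, a ≤ x.1 ∧ x.1 < a' ∧ b ≤ x.2 ∧ x.2 < b' ∧ R x.1 x.2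
  anti : ∀ x ∈ P, ∀ y ∈ P, x ≠ y → (x.1 < y.1 ∧ y.2 < x.2) ∨ (y.1 < x.1 ∧ x.2 < y.2)

namespace IsFold

variable {R : ℕ → ℕ → Prop} {P : Finset (ℕ × ℕ)} {a a' b b' : ℕ}

theorem mono {S : ℕ → ℕ → Prop} (hP : IsFold R P a a' b b')
    (hS : ∀ x ∈ P, R x.1 x.2 → S x.1 x.2) : IsFold S P a a' b b' where
  mem x hx := by
    obtain ⟨h1, h2, h3, h4, h5⟩ := hP.mem x hx
    exact ⟨h1, h2, h3, h4, hS x hx h5⟩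
  anti := hP.anti

theorem swap (hP : IsFold R P a a' b b') :
    IsFold (fun u v => R v u) (P.map (Equiv.prodComm ℕ ℕ).toEmbedding) b b' a a' where
  mem x hx := by
    simp only [Finset.mem_map] at hx
    obtain ⟨y, hy, rfl⟩ := hx
    obtain ⟨h1, h2, h3, h4, h5⟩ := hP.mem y hy
    exact ⟨h3, h4, h1, h2, h5⟩
  anti x hx y hy hne := by
    simp only [Finset.mem_map] at hx hy
    obtain ⟨x, hx, rfl⟩ := hx
    obtain ⟨y, hy, rfl⟩ := hy
    have := hP.anti x hx y hy (fun h => hne (by rw [h]))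
    simp only [Equiv.coe_toEmbedding, Equiv.prodComm_apply, Prod.fst_swap, Prod.snd_swap]
    tauto

theorem split (hP : IsFold R P a a' b b') (hb : b ≤ b') (c : ℕ) :
    ∃ e, b ≤ e ∧ e ≤ b' ∧ IsFold R (P.filter fun x => x.1 < c) a c e b' ∧
      IsFold R (P.filter fun x => ¬ x.1 < c) c a' b e := by
  refine ⟨max b ((P.filter fun x => ¬ x.1 < c).sup fun x => x.2 + 1), le_max_left _ _, ?_,
    ⟨?_, ?_⟩, ⟨?_, ?_⟩⟩
  · refine max_le hb (Finset.sup_le fun x hx => ?_)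
    have := hP.mem x (Finset.mem_filter.1 hx).1
    omega
  · intro x hx
    rw [Finset.mem_filter] at hx
    obtain ⟨h1, h2, h3, h4, h5⟩ := hP.mem x hx.1
    refine ⟨h1, hx.2, max_le h3 (Finset.sup_le fun y hy => ?_), h4, h5⟩
    rw [Finset.mem_filter] at hy
    have h6 := hP.anti x hx.1 y hy.1 (by rintro rfl; exact hy.2 hx.2)
    omega
  · exact fun x hx y hy => hP.anti x (Finset.mem_filter.1 hx).1 y (Finset.mem_filter.1 hy).1
  · intro x hx
    have hx' := Finset.mem_filter.1 hx
    obtain ⟨h1, h2, h3, h4, h5⟩ := hP.mem x hx'.1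
    refine ⟨by omega, h2, h3, lt_max_of_lt_right ?_, h5⟩
    exact Finset.le_sup (f := fun x : ℕ × ℕ => x.2 + 1) hx
  · exact fun x hx y hy => hP.anti x (Finset.mem_filter.1 hx).1 y (Finset.mem_filter.1 hy).1

theorem injOn_fst (hP : IsFold R P a a' b b') : Set.InjOn Prod.fst (P : Set (ℕ × ℕ)) := by
  intro x hx y hy hxy
  by_contra hne
  have := hP.anti x hx y hy hne
  omega

theorem injOn_snd (hP : IsFold R P a a' b b') : Set.InjOn Prod.snd (P : Set (ℕ × ℕ)) := by
  intro x hx y hy hxy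
  by_contra hne
  have := hP.anti x hx y hy hne
  omega

end IsFold

/-- A linear bound for folds whose first entries stay in one block of length `A` extends to all
folds, the additive error being paid once per block. -/
theorem sum_le_of_blocks_fst {R : ℕ → ℕ → Prop} {w : ℕ × ℕ → ℝ} {A : ℕ} (hA : 0 < A)
    {α β E : ℝ} (hE : 0 ≤ E)
    (base : ∀ P a a' b b', a ≤ a' → b ≤ b' → a' ≤ (a / A + 1) * A → IsFold R P a a' b b' →
      ∑ x ∈ P, w x ≤ α * (a' - a) + β * (b' - b) + E)
    {P : Finset (ℕ × ℕ)} {a a' b b' : ℕ} (ha : a ≤ a') (hb : b ≤ b')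
    (hP : IsFold R P a a' b b') :
    ∑ x ∈ P, w x ≤ α * (a' - a) + β * (b' - b) + E * ((a' - a) / A + 2) := by
  have key : ∀ n : ℕ, ∀ P a a' b b', a ≤ a' → b ≤ b' → a' ≤ (a / A + n + 1) * A →
      IsFold R P a a' b b' →
      ∑ x ∈ P, w x ≤ α * (a' - a) + β * (b' - b) + E * (n + 1) := by
    intro n
    induction n with
    | zero =>
      intro P a a' b b' ha hb h hP
      simpa using base P a a' b b' ha hb h hP
    | succ n ih =>
      intro P a a' b b' ha hb h hP
      by_cases hc : a' ≤ (a / A + 1) * A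
      · refine (base P a a' b b' ha hb hc hP).trans ?_
        push_cast
        nlinarith [mul_nonneg hE (Nat.cast_nonneg (α := ℝ) n)]
      · push Not at hc
        obtain ⟨e, he1, he2, hP1, hP2⟩ := hP.split hb ((a / A + 1) * A)
        have hac : a ≤ (a / A + 1) * A := by
          have := Nat.lt_mul_div_succ a hA
          rw [mul_comm]; exact this.le
        have h1 := base _ _ _ _ _ hac he2 le_rfl hP1
        have h2 := ih _ _ _ _ _ hc.le he1 (by
          rw [Nat.mul_div_cancel _ hA]; convert h using 2; push_cast; ring) hP2
        rw [← Finset.sum_filter_add_sum_filter_not P (fun x => x.1 < (a / A + 1) * A)]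
        refine (add_le_add h1 h2).trans (le_of_eq ?_)
        push_cast
        ring
  have h1 := key ((a' - a) / A + 1) P a a' b b' ha hb (by
    have h1 := Nat.lt_mul_div_succ a hA
    have h2 := Nat.lt_mul_div_succ (a' - a) hA
    have : (a / A + ((a' - a) / A + 1) + 1) * A
      = A * (a / A + 1) + A * ((a' - a) / A + 1) := by ring
    omega) hP
  refine h1.trans ?_
  have h3 : (((a' - a) / A : ℕ) : ℝ) ≤ ((a' : ℝ) - a) / A := by
    have := @Nat.cast_div_le ℝ _ _ _ (a' - a) A
    rwa [Nat.cast_sub ha] at this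
  push_cast
  have := mul_le_mul_of_nonneg_left h3 hE
  linarith

theorem sum_le_of_blocks_snd {R : ℕ → ℕ → Prop} {w : ℕ × ℕ → ℝ} {A : ℕ} (hA : 0 < A)
    {α β E : ℝ} (hE : 0 ≤ E)
    (base : ∀ P a a' b b', a ≤ a' → b ≤ b' → b' ≤ (b / A + 1) * A → IsFold R P a a' b b' →
      ∑ x ∈ P, w x ≤ α * (a' - a) + β * (b' - b) + E)
    {P : Finset (ℕ × ℕ)} {a a' b b' : ℕ} (ha : a ≤ a') (hb : b ≤ b')
    (hP : IsFold R P a a' b b') :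
    ∑ x ∈ P, w x ≤ α * (a' - a) + β * (b' - b) + E * ((b' - b) / A + 2) := by
  have := sum_le_of_blocks_fst (R := fun u v => R v u) (w := fun x => w x.swap) (α := β) (β := α)
    hA hE (fun Q c c' d d' hc hd hcA hQ => by
      have := base _ _ _ _ _ hd hc hcA hQ.swap
      rw [Finset.sum_map] at this
      simp only [Equiv.coe_toEmbedding, Equiv.prodComm_apply] at this
      linarith) hb ha hP.swap
  rw [Finset.sum_map] at this
  simp only [Equiv.coe_toEmbedding, Equiv.prodComm_apply, Prod.swap_swap] at this
  linarith

/-- If `y` is the colour of `v`, then `u` lies in the majority part of its period according to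
whether `y` differs from the majority colour of its run. -/
theorem decide_mod_lt_of_layerWord_ne {e B h g u r : ℕ} {y : Bool} (hu : layerWord e B h g u ≠ y)
    (hr : u / e / B = r) : decide (u / e % h < g) = (decide (r % 2 = 0) == !y) := by
  unfold layerWord at hu
  rw [hr] at hu
  revert hu
  generalize decide (r % 2 = 0) = s
  generalize decide (u / e % h < g) = t
  revert s t y
  decide

theorem sum_weight_le_of_run {e B e' B' h g g' r : ℕ} (he : 0 < e) (he' : 0 < e') (hg : 0 < g)
    (hh : h = g + g') {P : Finset (ℕ × ℕ)} {a a' b b' : ℕ} (ha : a ≤ a') (hb : b ≤ b')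
    (hP : IsFold (fun u v => layerWord e B h g u ≠ layerWord e' B' h g v ∧ u / e / B = r)
      P a a' b b') :
    ∑ x ∈ P, (if x.1 / e % h < g then (g' / g : ℝ) else 1) ≤
      (g' / h : ℝ) * (a' - a) + 0 * (b' - b) + (g' * e : ℝ) * ((b' - b) / e' + 2) := by
  have hh0 : 0 < h := by omega
  have hgR : (0 : ℝ) < g := by exact_mod_cast hg
  have hhR : (0 : ℝ) < h := by exact_mod_cast hh0
  have heR : (0 : ℝ) < e := by exact_mod_cast he
  refine sum_le_of_blocks_snd he' (by positivity) ?_ ha hb hP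
  intro Q c c' d d' hc hd hd' hQ
  have hconst : ∀ x ∈ Q, decide (x.1 / e % h < g) =
      (decide (r % 2 = 0) == !layerWord e' B' h g d) := by
    intro x hx
    obtain ⟨-, -, h3, h4, h5, h6⟩ := hQ.mem x hx
    have h7 : x.2 / e' = d / e' := by
      apply le_antisymm
      · exact Nat.lt_succ_iff.1 ((Nat.div_lt_iff_lt_mul he').2 (h4.trans_le hd'))
      · exact Nat.div_le_div_right h3
    have h8 : layerWord e' B' h g x.2 = layerWord e' B' h g d := by
      unfold layerWord; rw [h7]
    rw [h8] at h5
    exact decide_mod_lt_of_layerWord_ne h5 h6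
  have hcard : ∀ q : ℕ → Prop, ∀ [DecidablePred q], (∀ x ∈ Q, q x.1) →
      (Q.card : ℝ) ≤ ((Finset.Ico c c').filter q).card := by
    intro q _ hq
    rw [← Finset.card_image_of_injOn hQ.injOn_fst]
    refine Nat.cast_le.2 (Finset.card_le_card fun z hz => ?_)
    obtain ⟨x, hx, rfl⟩ := Finset.mem_image.1 hz
    have := hQ.mem x hx
    simp only [Finset.mem_filter, Finset.mem_Ico]
    exact ⟨⟨this.1, this.2.1⟩, hq x hx⟩
  cases hy : (decide (r % 2 = 0) == !layerWord e' B' h g d) with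
  | true =>
    have hmaj : ∀ x ∈ Q, x.1 / e % h < g := fun x hx => by
      have := hconst x hx
      rw [hy] at this
      exact of_decide_eq_true this
    have h1 := (hcard _ hmaj).trans (card_filter_Ico_le_of_periodic (Nat.mul_pos hh0 he)
      (periodic_div_mod_lt e h g he) (count_div_mod_lt e h g he (by omega)) c c' hc)
    rw [Finset.sum_congr rfl (fun x hx => if_pos (hmaj x hx)), Finset.sum_const, nsmul_eq_mul]
    refine (mul_le_mul_of_nonneg_right h1 (by positivity)).trans (le_of_eq ?_)
    push_cast
    field_simp
    ring
  | false =>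
    have hmin : ∀ x ∈ Q, ¬ x.1 / e % h < g := fun x hx => by
      have := hconst x hx
      rw [hy] at this
      exact of_decide_eq_false this
    have hcount : (h * e).count (fun z => ¬ z / e % h < g) = g' * e := by
      have h1 := count_div_mod_lt e h g he (by omega)
      rw [Nat.count_eq_card_filter_range] at h1 ⊢
      have h2 := Finset.card_filter_add_card_filter_not (s := Finset.range (h * e))
        (fun z => z / e % h < g)
      rw [h1, Finset.card_range] at h2
      have h3 : h * e = g * e + g' * e := by rw [hh, add_mul]
      rw [h3] at h2
      convert Nat.add_left_cancel h2 using 3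
      rw [h3]
    have h1 := (hcard _ hmin).trans (card_filter_Ico_le_of_periodic (Nat.mul_pos hh0 he)
      (fun z => by
        have := periodic_div_mod_lt e h g he z
        simp only [eq_iff_iff] at this ⊢
        exact not_congr this) hcount c c' hc)
    rw [Finset.sum_congr rfl (fun x hx => if_neg (hmin x hx)), Finset.sum_const, nsmul_eq_mul]
    refine (mul_le_mul_of_nonneg_right h1 (by positivity)).trans (le_of_eq ?_)
    push_cast
    field_simp
    ring

theorem card_majority_le {e B e' B' h g r : ℕ} (he' : 0 < e') (hB' : 0 < B')
    (hd : h ∣ B') {P : Finset (ℕ × ℕ)} {a a' b b' : ℕ} (hb : b ≤ b')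
    (hP : IsFold (fun u v => layerWord e B h g u ≠ layerWord e' B' h g v ∧ u / e / B = r)
      P a a' b b') :
    ((P.filter fun x => x.1 / e % h < g).card : ℝ) ≤ (1 / 2 : ℝ) * (b' - b) + (B' * e' : ℕ) := by
  have h0 : 0 < B' * e' := Nat.mul_pos hB' he'
  set y : Bool := !decide (r % 2 = 0) with hy
  have h1 : (P.filter fun x => x.1 / e % h < g).card ≤
      ((Finset.Ico b b').filter fun z => layerWord e' B' h g z = y).card := by
    rw [← Finset.card_image_of_injOn (f := Prod.snd)
      (hP.injOn_snd.mono (by exact_mod_cast Finset.filter_subset _ P))]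
    refine Finset.card_le_card fun z hz => ?_
    obtain ⟨x, hx, rfl⟩ := Finset.mem_image.1 hz
    rw [Finset.mem_filter] at hx
    obtain ⟨-, -, h3, h4, h5, h6⟩ := hP.mem x hx.1
    have h7 := decide_mod_lt_of_layerWord_ne h5 h6
    rw [decide_eq_true hx.2] at h7
    simp only [Finset.mem_filter, Finset.mem_Ico]
    refine ⟨⟨h3, h4⟩, ?_⟩
    rw [hy]
    revert h7
    generalize decide (r % 2 = 0) = s
    generalize layerWord e' B' h g x.2 = t
    revert s t
    decide
  have h2 := card_filter_Ico_le_of_periodic (T := 2 * (B' * e')) (by omega)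
    (pr := fun z => layerWord e' B' h g z = y)
    (fun z => by simp only [layerWord_periodic g he' hB' hd z])
    (count_layerWord g he' hB' hd y) b b' hb
  have h0R : ((B' * e' : ℕ) : ℝ) ≠ 0 := by exact_mod_cast h0.ne'
  calc ((P.filter fun x => x.1 / e % h < g).card : ℝ)
      ≤ (((Finset.Ico b b').filter fun z => layerWord e' B' h g z = y).card : ℝ) := by
        exact_mod_cast h1
    _ ≤ _ := h2
    _ = _ := by
      congr 2
      rw [Nat.cast_mul 2]
      push_cast at h0R ⊢
      field_simp

/-- Folds between a coarse word with fine impurities and a finer word with coarser impurities. -/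
theorem card_le_of_layers {e B e' B' h g g' D : ℕ} (he : 0 < e) (he' : 0 < e') (hB : 0 < B)
    (hB' : 0 < B') (hd : h ∣ B') (hg : 0 < g) (hh : h = g + g') (hD : 0 < D)
    (hq : (1 : ℝ) ≤ g' / g + 2 * (g' / h)) (h_dirt : D * e ≤ e') (h_run : D * (B' * e') ≤ B * e)
    (h_period : D * (h * e) ≤ B * e)
    {P : Finset (ℕ × ℕ)} {a a' b b' : ℕ} (ha : a ≤ a') (hb : b ≤ b')
    (hP : IsFold (fun u v => layerWord e B h g u ≠ layerWord e' B' h g v) P a a' b b') :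
    (P.card : ℝ) ≤ (g' / h + 4 / D : ℝ) * (a' - a) + (g' / h + h / D : ℝ) * (b' - b) +
      8 * (B * e : ℕ) / D := by
  have hgR : (0 : ℝ) < g := by exact_mod_cast hg
  have hhR : (0 : ℝ) < h := by exact_mod_cast (show 0 < h by omega)
  have hDR : (0 : ℝ) < D := by exact_mod_cast hD
  have heR : (0 : ℝ) < e := by exact_mod_cast he
  have heR' : (0 : ℝ) < e' := by exact_mod_cast he'
  have hA : 0 < B * e := Nat.mul_pos hB he
  have hAR : (0 : ℝ) < (B * e : ℕ) := by exact_mod_cast hA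
  have hgh : (g' : ℝ) ≤ h := by exact_mod_cast (show g' ≤ h by omega)
  have hqh : (g' / h : ℝ) ≤ 1 := (div_le_one hhR).2 hgh
  have := sum_le_of_blocks_fst (w := fun _ => 1) (α := g' / h) (β := g' / h + h / D)
    (E := 4 * (B * e : ℕ) / D) hA (by positivity) (by
      intro Q c c' d d' hc hd' hcA hQ
      have hQ' : IsFold (fun u v => layerWord e B h g u ≠ layerWord e' B' h g v ∧
          u / e / B = c / (B * e)) Q c c' d d' :=
        ⟨fun x hx => by
          obtain ⟨h1, h2, h3, h4, h5⟩ := hQ.mem x hx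
          refine ⟨h1, h2, h3, h4, h5, ?_⟩
          rw [Nat.div_div_eq_div_mul, mul_comm e B]
          apply le_antisymm
          · exact Nat.lt_succ_iff.1 ((Nat.div_lt_iff_lt_mul hA).2 (h2.trans_le hcA))
          · exact Nat.div_le_div_right h1, hQ.anti⟩
      have h1 := sum_weight_le_of_run he he' hg hh hc hd' hQ'
      have h2 := card_majority_le he' hB' hd hd' hQ'
      rw [Finset.sum_ite, Finset.sum_const, Finset.sum_const, nsmul_eq_mul, nsmul_eq_mul] at h1
      have h3 : ((Q.filter fun x => x.1 / e % h < g).card : ℝ) +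
          (Q.filter fun x => ¬ x.1 / e % h < g).card = Q.card := by
        exact_mod_cast Finset.card_filter_add_card_filter_not _
      rw [Finset.sum_const, nsmul_eq_mul, mul_one, ← h3]
      set m₁ : ℝ := ((Q.filter fun x => x.1 / e % h < g).card : ℝ)
      set m₂ : ℝ := ((Q.filter fun x => ¬ x.1 / e % h < g).card : ℝ)
      have hm₁ : m₁ ≤ (g' / g + 2 * (g' / h)) * m₁ :=
        le_mul_of_one_le_left (Nat.cast_nonneg _) hq
      have h4 : 2 * (g' / h : ℝ) * m₁ ≤
          2 * (g' / h : ℝ) * ((1 / 2 : ℝ) * (d' - d) + (B' * e' : ℕ)) :=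
        mul_le_mul_of_nonneg_left h2 (by positivity)
      have hs : (0 : ℝ) ≤ d' - d := by
        have : (d : ℝ) ≤ d' := by exact_mod_cast hd'
        linarith
      have h5 : (g' * e : ℝ) * ((d' - d) / e') ≤ h / D * (d' - d) := by
        have h_dirt' : (D * e : ℝ) ≤ e' := by exact_mod_cast h_dirt
        rw [mul_div_assoc', div_mul_eq_mul_div, div_le_div_iff₀ heR' hDR]
        calc (g' * e * (d' - d) * D : ℝ) = g' * (d' - d) * (D * e) := by ring
          _ ≤ h * (d' - d) * e' := by gcongr
      have h6 : (g' * e : ℝ) ≤ (B * e : ℕ) / D := by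
        rw [le_div_iff₀ hDR]
        have : (D * (h * e) : ℝ) ≤ (B * e : ℕ) := by exact_mod_cast h_period
        calc (g' * e * D : ℝ) = D * (g' * e) := by ring
          _ ≤ D * (h * e) := by gcongr
          _ ≤ _ := this
      have h7 : (g' / h : ℝ) * (B' * e' : ℕ) ≤ (B * e : ℕ) / D := by
        have h8 : ((B' * e' : ℕ) : ℝ) ≤ (B * e : ℕ) / D := by
          rw [le_div_iff₀ hDR, mul_comm]
          exact_mod_cast h_run
        exact (mul_le_of_le_one_left (Nat.cast_nonneg _) hqh).trans h8
      have h9 : 4 * ((B * e : ℕ) : ℝ) / D = 4 * ((B * e : ℕ) / D) := by ring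
      rw [h9]
      linarith) ha hb hP
  rw [Finset.sum_const, nsmul_eq_mul, mul_one] at this
  refine this.trans (le_of_eq ?_)
  field_simp
  ring

/-- `K` consecutive segments of length `L`, repeated with period `K * L`; the later a segment, the
shorter its runs and the longer the periods inside its runs. -/
def segmentColor (D K h g L z : ℕ) : Bool :=
  layerWord (D ^ (z / L % K + 1)) (h * D ^ (2 * (K - z / L % K))) h g z

theorem segmentColor_eq {D K h g L z i : ℕ} (hz : z / L % K = i) :
    segmentColor D K h g L z = layerWord (D ^ (i + 1)) (h * D ^ (2 * (K - i))) h g z := by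
  subst hz; rfl

theorem run_length_mul_pow {D K h i : ℕ} (hi : i < K) :
    2 * (h * D ^ (2 * (K - i)) * D ^ (i + 1)) * D ^ i = 2 * (h * D ^ (2 * K + 1)) := by
  have : 2 * K + 1 = 2 * (K - i) + (i + 1) + i := by omega
  rw [this, pow_add, pow_add]
  ring

theorem segmentColor_periodic {D K h : ℕ} (g : ℕ) (hD : 0 < D) (hK : 0 < K) (hh : 0 < h) :
    Function.Periodic (segmentColor D K h g (2 * (h * D ^ (2 * K + 1))))
      (K * (2 * (h * D ^ (2 * K + 1)))) := by
  intro z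
  have hL : 0 < 2 * (h * D ^ (2 * K + 1)) := by positivity
  have hi : z / (2 * (h * D ^ (2 * K + 1))) % K < K := Nat.mod_lt _ hK
  rw [segmentColor_eq (i := z / (2 * (h * D ^ (2 * K + 1))) % K)
      (by rw [Nat.add_mul_div_right _ _ hL, Nat.add_mod_right]),
    segmentColor_eq (z := z) rfl]
  generalize z / (2 * (h * D ^ (2 * K + 1))) % K = i at hi
  have h1 : K * (2 * (h * D ^ (2 * K + 1))) =
      K * D ^ i * (2 * (h * D ^ (2 * (K - i)) * D ^ (i + 1))) := by
    rw [← run_length_mul_pow hi]; ring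
  rw [h1]
  exact (layerWord_periodic g (by positivity) (by positivity) (Dvd.intro _ rfl)).nat_mul _ z

theorem segmentColor_congr {D K h g z z' : ℕ} (hz : z / D = z' / D) :
    segmentColor D K h g (2 * (h * D ^ (2 * K + 1))) z =
      segmentColor D K h g (2 * (h * D ^ (2 * K + 1))) z' := by
  have h1 : 2 * (h * D ^ (2 * K + 1)) = D * (2 * (h * D ^ (2 * K))) := by ring
  rw [h1]
  unfold segmentColor layerWord
  simp only [← Nat.div_div_eq_div_mul z D, ← Nat.div_div_eq_div_mul z' D, pow_succ', hz]

theorem card_segmentColor {D K h : ℕ} (g : ℕ) (hD : 0 < D) (hh : 0 < h) :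
    ((Finset.range (K * (2 * (h * D ^ (2 * K + 1))))).filter fun z =>
      segmentColor D K h g (2 * (h * D ^ (2 * K + 1))) z = true).card =
      K * (h * D ^ (2 * K + 1)) := by
  set L := 2 * (h * D ^ (2 * K + 1)) with hL
  have hL0 : 0 < L := by positivity
  have key : ∀ m ≤ K, ((Finset.range (m * L)).filter fun z =>
      segmentColor D K h g L z = true).card = m * (h * D ^ (2 * K + 1)) := by
    intro m
    induction m with
    | zero => simp
    | succ m ih =>
      intro hm
      have h1 : Finset.range ((m + 1) * L) =
          Finset.range (m * L) ∪ Finset.Ico (m * L) (m * L + L) := by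
        rw [Finset.range_eq_Ico, Finset.range_eq_Ico,
          Finset.Ico_union_Ico_eq_Ico (by omega) (by omega), Nat.succ_mul]
      rw [h1, Finset.filter_union, Finset.card_union_of_disjoint, ih (by omega)]
      · have h2 : ((Finset.Ico (m * L) (m * L + L)).filter fun z =>
            segmentColor D K h g L z = true) = (Finset.Ico (m * L) (m * L + L)).filter fun z =>
            layerWord (D ^ (m + 1)) (h * D ^ (2 * (K - m))) h g z = true := by
          refine Finset.filter_congr fun z hz => ?_
          rw [Finset.mem_Ico] at hz
          have : z / L = m :=
            Nat.div_eq_of_lt_le (by linarith) (by rw [Nat.succ_mul]; exact hz.2)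
          rw [segmentColor_eq (i := m) (by rw [this, Nat.mod_eq_of_lt (by omega)])]
        have hLm : L = 2 * (h * D ^ (2 * (K - m)) * D ^ (m + 1)) * D ^ m :=
          (run_length_mul_pow (by omega)).symm
        have h3 := card_filter_Ico_mul_of_periodic
          (pr := fun z => layerWord (D ^ (m + 1)) (h * D ^ (2 * (K - m))) h g z = true)
          (fun z => by
            simp only [layerWord_periodic g (e := D ^ (m + 1)) (B := h * D ^ (2 * (K - m)))
              (h := h) (by positivity) (by positivity) (Dvd.intro _ rfl) z])
          (count_layerWord g (by positivity) (by positivity) (Dvd.intro _ rfl) true)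
          (D ^ m) (m * L)
        rw [← hLm] at h3
        rw [h2, h3]
        have h4 : 2 * (h * D ^ (2 * (K - m)) * D ^ (m + 1) * D ^ m) =
            2 * (h * D ^ (2 * K + 1)) := by rw [← hL, hLm]; ring
        have h5 := Nat.eq_of_mul_eq_mul_left two_pos h4
        rw [h5]
        ring
      · rw [Finset.range_eq_Ico]
        exact Finset.disjoint_filter_filter (Finset.Ico_disjoint_Ico_consecutive _ _ _)
  exact key K le_rfl

theorem card_le_of_two_segments {D K h g g' L i j : ℕ} (hD : 0 < D) (hg : 0 < g)
    (hh : h = g + g') (hL : L = 2 * (h * D ^ (2 * K + 1)))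
    (hq : (1 : ℝ) ≤ g' / g + 2 * (g' / h)) (hij : i < j) (hj : j < K)
    {P : Finset (ℕ × ℕ)} {a a' b b' : ℕ} (ha : a ≤ a') (hb : b ≤ b')
    (hP : IsFold (fun u v => segmentColor D K h g L u ≠ segmentColor D K h g L v ∧
      u / L % K = i ∧ v / L % K = j) P a a' b b') :
    (P.card : ℝ) ≤ (g' / h + (h + 4) / D : ℝ) * (a' - a) +
      (g' / h + (h + 4) / D : ℝ) * (b' - b) + 8 * L / D := by
  have hh0 : 0 < h := by omega
  have hDR : (0 : ℝ) < D := by exact_mod_cast hD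
  have h1 := card_le_of_layers (e := D ^ (i + 1)) (B := h * D ^ (2 * (K - i)))
    (e' := D ^ (j + 1)) (B' := h * D ^ (2 * (K - j))) (D := D) (by positivity) (by positivity)
    (by positivity) (by positivity) (Dvd.intro _ rfl) hg hh hD hq
    (by rw [← pow_succ']; exact Nat.pow_le_pow_right hD (by omega))
    (by
      have h1 : D * (h * D ^ (2 * (K - j)) * D ^ (j + 1)) = h * D ^ (2 * (K - j) + (j + 1) + 1) := by
        ring
      rw [h1, mul_assoc h, ← pow_add]
      exact Nat.mul_le_mul_left _ (Nat.pow_le_pow_right hD (by omega)))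
    (by
      have h1 : D * (h * D ^ (i + 1)) = h * D ^ (i + 1 + 1) := by ring
      rw [h1, mul_assoc h, ← pow_add]
      exact Nat.mul_le_mul_left _ (Nat.pow_le_pow_right hD (by omega)))
    ha hb (hP.mono fun x _ hx => by
      rw [← segmentColor_eq hx.2.1, ← segmentColor_eq hx.2.2]; exact hx.1)
  refine h1.trans ?_
  have h2 : (a : ℝ) ≤ a' := by exact_mod_cast ha
  have h3 : (b : ℝ) ≤ b' := by exact_mod_cast hb
  have h4 : h * D ^ (2 * (K - i)) * D ^ (i + 1) ≤ L := by
    rw [hL, ← run_length_mul_pow (hij.trans hj)]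
    have h5 : 0 < D ^ i := by positivity
    nlinarith [Nat.zero_le (h * D ^ (2 * (K - i)) * D ^ (i + 1))]
  have h5 : ((h * D ^ (2 * (K - i)) * D ^ (i + 1) : ℕ) : ℝ) ≤ L := by exact_mod_cast h4
  gcongr
  · linarith
  · have : (0 : ℝ) ≤ h := by positivity
    linarith

theorem card_le_of_segments_ne {D K h g g' L : ℕ} (hD : 0 < D) (hK : 0 < K) (hg : 0 < g)
    (hh : h = g + g') (hL : L = 2 * (h * D ^ (2 * K + 1)))
    (hq : (1 : ℝ) ≤ g' / g + 2 * (g' / h))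
    {P : Finset (ℕ × ℕ)} {a a' b b' : ℕ} (ha : a ≤ a') (hb : b ≤ b')
    (hP : IsFold (fun u v => segmentColor D K h g L u ≠ segmentColor D K h g L v ∧
      u / L % K ≠ v / L % K) P a a' b b') :
    (P.card : ℝ) ≤ (g' / h + (h + 20) / D : ℝ) * (a' - a) +
      (g' / h + (h + 12) / D : ℝ) * (b' - b) + 32 * L / D := by
  have hh0 : 0 < h := by omega
  have hL0 : 0 < L := by rw [hL]; positivity
  have hLR : (0 : ℝ) < L := by exact_mod_cast hL0
  have hDR : (0 : ℝ) < D := by exact_mod_cast hD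
  have := sum_le_of_blocks_fst (w := fun _ => 1) (α := g' / h + (h + 4) / D)
    (β := g' / h + (h + 12) / D) (E := 16 * L / D) hL0 (by positivity)
    (fun Q c c' d d' hc hd hcL hQ => by
      have := sum_le_of_blocks_snd (R := fun u v => (segmentColor D K h g L u ≠
          segmentColor D K h g L v ∧ u / L % K ≠ v / L % K) ∧ u / L = c / L)
        (w := fun _ => 1) (α := g' / h + (h + 4) / D)
        (β := g' / h + (h + 4) / D) (E := 8 * L / D) hL0 (by positivity)
        (fun Q c₁ c₁' d d' hc hd hdL hQ => by
          rw [Finset.sum_const, nsmul_eq_mul, mul_one]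
          have hseg : ∀ x ∈ Q, x.1 / L = c / L ∧ x.2 / L = d / L := fun x hx => by
            obtain ⟨h1, h2, h3, h4, h5, h6⟩ := hQ.mem x hx
            refine ⟨h6, le_antisymm ?_ (Nat.div_le_div_right h3)⟩
            exact Nat.lt_succ_iff.1 ((Nat.div_lt_iff_lt_mul hL0).2 (h4.trans_le hdL))
          have hQ' := hQ.mono (S := fun u v => segmentColor D K h g L u ≠
              segmentColor D K h g L v ∧ u / L % K = c / L % K ∧ v / L % K = d / L % K)
            fun x hx h => ⟨h.1.1, by rw [(hseg x hx).1], by rw [(hseg x hx).2]⟩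
          rcases lt_trichotomy (c / L % K) (d / L % K) with hlt | heq | hgt
          · exact card_le_of_two_segments hD hg hh hL hq hlt (Nat.mod_lt _ hK) hc hd hQ'
          · have hQ0 : Q = ∅ := by
              refine Finset.eq_empty_of_forall_notMem fun x hx => ?_
              apply (hQ.mem x hx).2.2.2.2.1.2
              rw [(hseg x hx).1, (hseg x hx).2, heq]
            have h2 : (c₁ : ℝ) ≤ c₁' := by exact_mod_cast hc
            have h3 : (d : ℝ) ≤ d' := by exact_mod_cast hd
            rw [hQ0, Finset.card_empty, Nat.cast_zero]
            have h4 : (0 : ℝ) ≤ c₁' - c₁ := by linarith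
            have h5 : (0 : ℝ) ≤ d' - d := by linarith
            positivity
          · have h2 := card_le_of_two_segments hD hg hh hL hq hgt (Nat.mod_lt _ hK) hd hc
              (hQ'.swap.mono fun x _ hx => ⟨hx.1.symm, hx.2.2, hx.2.1⟩)
            rw [Finset.card_map] at h2
            linarith) hc hd
        ⟨fun x hx => by
          obtain ⟨h1, h2, h3, h4, h5⟩ := hQ.mem x hx
          refine ⟨h1, h2, h3, h4, h5, le_antisymm ?_ (Nat.div_le_div_right h1)⟩
          exact Nat.lt_succ_iff.1 ((Nat.div_lt_iff_lt_mul hL0).2 (h2.trans_le hcL)), hQ.anti⟩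
      refine this.trans (le_of_eq ?_)
      field_simp
      ring) ha hb hP
  rw [Finset.sum_const, nsmul_eq_mul, mul_one] at this
  refine this.trans (le_of_eq ?_)
  field_simp
  ring

/-- A fold of the whole necklace meets a segment against itself only around its two fold points. -/
theorem card_same_segment_le {K L k m : ℕ} (hL : 0 < L) {R : ℕ → ℕ → Prop} {P : Finset (ℕ × ℕ)}
    (hP : IsFold R P k (k + m) (k + m) (k + K * L)) :
    (P.filter fun x => x.1 / L % K = x.2 / L % K).card ≤ 2 * L := by
  have hIco : ∀ z q, z / L = q → z ∈ Finset.Ico (q * L) (q * L + L) := by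
    rintro z _ rfl
    have h1 := Nat.div_mul_le_self z L
    have h2 := Nat.lt_mul_div_succ z hL
    rw [Finset.mem_Ico]
    refine ⟨h1, ?_⟩
    calc z < L * (z / L + 1) := h2
      _ = _ := by ring
  rw [← Finset.card_image_of_injOn (f := Prod.fst)
    (hP.injOn_fst.mono (by exact_mod_cast Finset.filter_subset _ P))]
  calc _ ≤ (Finset.Ico ((k + m) / L * L) ((k + m) / L * L + L) ∪
        Finset.Ico (k / L * L) (k / L * L + L)).card := by
        refine Finset.card_le_card fun z hz => ?_
        obtain ⟨x, hx, rfl⟩ := Finset.mem_image.1 hz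
        rw [Finset.mem_filter] at hx
        obtain ⟨h1, h2, h3, h4, -⟩ := hP.mem x hx.1
        have g1 : x.1 / L ≤ (k + m) / L := Nat.div_le_div_right h2.le
        have g2 : (k + m) / L ≤ x.2 / L := Nat.div_le_div_right h3
        have g3 : k / L ≤ x.1 / L := Nat.div_le_div_right h1
        have g4 : x.2 / L ≤ k / L + K := by
          rw [← Nat.add_mul_div_right _ _ hL]; exact Nat.div_le_div_right h4.le
        obtain ⟨q, hq⟩ := (Nat.modEq_iff_dvd' (g1.trans g2)).1 hx.2
        rw [Finset.mem_union]
        rcases Nat.eq_zero_or_pos q with rfl | hq0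
        · exact Or.inl (hIco _ _ (by omega))
        · have : K ≤ K * q := Nat.le_mul_of_pos_right _ hq0
          exact Or.inr (hIco _ _ (by omega))
    _ ≤ _ := Finset.card_union_le _ _
    _ = 2 * L := by simp [two_mul]

theorem card_fold_le {D K h g g' L k m : ℕ} (hD : 0 < D) (hK : 0 < K) (hg : 0 < g)
    (hh : h = g + g') (hL : L = 2 * (h * D ^ (2 * K + 1)))
    (hq : (1 : ℝ) ≤ g' / g + 2 * (g' / h)) (hm : m ≤ K * L) {P : Finset (ℕ × ℕ)}
    (hP : IsFold (fun u v => segmentColor D K h g L u ≠ segmentColor D K h g L v) P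
      k (k + m) (k + m) (k + K * L)) :
    (P.card : ℝ) ≤ (g' / h + (h + 52) / D + 2 / K : ℝ) * (K * L) := by
  have hh0 : 0 < h := by omega
  have hL0 : 0 < L := by rw [hL]; positivity
  have hLR : (0 : ℝ) < L := by exact_mod_cast hL0
  have hDR : (0 : ℝ) < D := by exact_mod_cast hD
  have hKR : (1 : ℝ) ≤ K := by exact_mod_cast hK
  have hmR : (m : ℝ) ≤ K * L := by exact_mod_cast hm
  have h1 := card_same_segment_le hL0 hP
  have h2 := card_le_of_segments_ne hD hK hg hh hL hq (by omega) (by omega)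
    (P := P.filter fun x => ¬ x.1 / L % K = x.2 / L % K)
    (a := k) (a' := k + m) (b := k + m) (b' := k + K * L)
    ⟨fun x hx => by
      rw [Finset.mem_filter] at hx
      obtain ⟨h1, h2, h3, h4, h5⟩ := hP.mem x hx.1
      exact ⟨h1, h2, h3, h4, h5, hx.2⟩,
      fun x hx y hy => hP.anti x (Finset.mem_filter.1 hx).1 y (Finset.mem_filter.1 hy).1⟩
  rw [← Finset.card_filter_add_card_filter_not (fun x : ℕ × ℕ => x.1 / L % K = x.2 / L % K)]
  have h1' : ((P.filter fun x => x.1 / L % K = x.2 / L % K).card : ℝ) ≤ 2 * L := by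
    exact_mod_cast h1
  push_cast at h2 ⊢
  refine (add_le_add h1' h2).trans ?_
  have h3 : ((g' : ℝ) / h + (h + 12) / D) * (k + K * L - (k + m)) ≤
      ((g' : ℝ) / h + (h + 20) / D) * (k + K * L - (k + m)) := by
    gcongr
    · linarith
    · norm_num
  have h4 : (32 * L / D : ℝ) ≤ 32 / D * (K * L) := by
    rw [div_mul_eq_mul_div]
    gcongr
    nlinarith
  have h5 : (2 / K : ℝ) * (K * L) = 2 * L := by field_simp
  have h6 : ((g' / h + (h + 52) / D + 2 / K : ℝ)) * (K * L) =
      (g' / h + (h + 20) / D : ℝ) * (K * L) + 32 / D * (K * L) + 2 / K * (K * L) := by ring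
  rw [h6, h5]
  linarith

theorem Fin.val_sub_eq_ite_of_origin {N : ℕ} (k x a : Fin N) :
    (x - a).val = if (a - k).val ≤ (x - k).val then (x - k).val - (a - k).val
      else N + (x - k).val - (a - k).val := by
  rw [Fin.val_sub_eq_ite x a, Fin.val_sub_eq_ite x k, Fin.val_sub_eq_ite a k]
  have := x.isLt
  have := a.isLt
  have := k.isLt
  split_ifs <;> omega

theorem Fin.val_add_val_sub_mod {N : ℕ} (k x : Fin N) : (k.val + (x - k).val) % N = x.val := by
  rw [Fin.val_sub_eq_ite]
  have hx := x.isLt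
  have := k.isLt
  split_ifs
  · rw [Nat.mod_eq_of_lt (by omega)]; omega
  · rw [show k.val + (N + x.val - k.val) = x.val + N by omega, Nat.add_mod_right,
      Nat.mod_eq_of_lt hx]

/-- The offsets from `k` of the two ends of a pair, the smaller one first. -/
def unrollPair {N : ℕ} (k : Fin N) (p : Fin N × Fin N) : ℕ × ℕ :=
  (k.val + min (p.1 - k).val (p.2 - k).val, k.val + max (p.1 - k).val (p.2 - k).val)

theorem crosses_of_unrollPair_lt {N : ℕ} {k : Fin N} {p q : Fin N × Fin N}
    (h₁ : (unrollPair k p).1 < (unrollPair k q).1) (h₂ : (unrollPair k q).1 < (unrollPair k p).2)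
    (h₃ : (unrollPair k p).2 < (unrollPair k q).2) : Crosses p q := by
  have hp1 := (p.1 - k).isLt
  have hp2 := (p.2 - k).isLt
  have hq1 := (q.1 - k).isLt
  have hq2 := (q.2 - k).isLt
  simp only [unrollPair] at h₁ h₂ h₃
  simp only [Crosses, strictBtw, Fin.val_sub_eq_ite_of_origin k p.1 p.2,
    Fin.val_sub_eq_ite_of_origin k p.2 p.1, Fin.val_sub_eq_ite_of_origin k q.1 p.1,
    Fin.val_sub_eq_ite_of_origin k q.1 p.2, Fin.val_sub_eq_ite_of_origin k q.2 p.1,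
    Fin.val_sub_eq_ite_of_origin k q.2 p.2]
  generalize (p.1 - k).val = x at *
  generalize (p.2 - k).val = y at *
  generalize (q.1 - k).val = z at *
  generalize (q.2 - k).val = w at *
  rcases le_total x y with hxy | hxy <;> rcases le_total z w with hzw | hzw <;>
    simp only [hxy, hzw, min_eq_left, min_eq_right, max_eq_left, max_eq_right] at h₁ h₂ h₃
  · left; split_ifs <;> omega
  · right; split_ifs <;> omega
  · right; split_ifs <;> omega
  · left; split_ifs <;> omega

theorem isFold_unrollPair {N : ℕ} {C : ℕ → Bool} (hC : Function.Periodic C N)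
    {M : Finset (Fin N × Fin N)} (hM : IsMatching M) (hX : CrossFree M)
    (hH : Heterogeneous (fun i : Fin N => C i.val) M) {k : Fin N} {m : ℕ}
    (hS : RespectsSecant M k m) :
    Set.InjOn (unrollPair k) (M : Set (Fin N × Fin N)) ∧
      IsFold (fun u v => C u ≠ C v) (M.image (unrollPair k)) k (k + m) (k + m) (k + N) := by
  obtain ⟨hm0, hmN, hS⟩ := hS
  have hsides : ∀ p ∈ M, ((p.1 - k).val < m ∧ m ≤ (p.2 - k).val) ∨
      ((p.2 - k).val < m ∧ m ≤ (p.1 - k).val) := fun p hp => by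
    have := hS p hp
    simp only [InArc] at this
    rcases this with ⟨h1, h2⟩ | ⟨h1, h2⟩ <;> omega
  have hinj : ∀ x y : Fin N, (x - k).val = (y - k).val → x = y := fun x y h => by
    apply Fin.ext
    rw [← Fin.val_add_val_sub_mod k x, ← Fin.val_add_val_sub_mod k y, h]
  have hcol : ∀ x : Fin N, C (k.val + (x - k).val) = C x.val := fun x => by
    rw [← hC.map_mod_nat, Fin.val_add_val_sub_mod]
  have hdist : ∀ p ∈ M, ∀ q ∈ M, p ≠ q → (p.1 - k).val ≠ (q.1 - k).val ∧
      (p.1 - k).val ≠ (q.2 - k).val ∧ (p.2 - k).val ≠ (q.1 - k).val ∧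
      (p.2 - k).val ≠ (q.2 - k).val := fun p hp q hq hpq => by
    obtain ⟨h1, h2, h3, h4⟩ := hM.2 p hp q hq hpq
    exact ⟨fun h => h1 (hinj _ _ h), fun h => h2 (hinj _ _ h), fun h => h3 (hinj _ _ h),
      fun h => h4 (hinj _ _ h)⟩
  have hbox : ∀ p ∈ M, k.val ≤ (unrollPair k p).1 ∧ (unrollPair k p).1 < k + m ∧
      k + m ≤ (unrollPair k p).2 ∧ (unrollPair k p).2 < k + N := fun p hp => by
    have h1 := (p.1 - k).isLt
    have h2 := (p.2 - k).isLt
    have h3 := hsides p hp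
    simp only [unrollPair]
    omega
  have hne : ∀ p ∈ M, ∀ q ∈ M, p ≠ q → (unrollPair k p).1 ≠ (unrollPair k q).1 ∧
      (unrollPair k p).2 ≠ (unrollPair k q).2 := fun p hp q hq hpq => by
    have h1 := hdist p hp q hq hpq
    simp only [unrollPair]
    omega
  refine ⟨fun p hp q hq h => ?_, ?_, ?_⟩
  · by_contra hpq
    exact (hne p hp q hq hpq).1 (by rw [h])
  · intro x hx
    obtain ⟨p, hp, rfl⟩ := Finset.mem_image.1 hx
    obtain ⟨h1, h2, h3, h4⟩ := hbox p hp
    refine ⟨h1, h2, h3, h4, ?_⟩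
    have hc : C p.1.val ≠ C p.2.val := hH p hp
    simp only [unrollPair]
    rcases le_total (p.1 - k).val (p.2 - k).val with h | h
    · rw [min_eq_left h, max_eq_right h, hcol, hcol]; exact hc
    · rw [min_eq_right h, max_eq_left h, hcol, hcol]; exact hc.symm
  · intro x hx y hy hxy
    obtain ⟨p, hp, rfl⟩ := Finset.mem_image.1 hx
    obtain ⟨q, hq, rfl⟩ := Finset.mem_image.1 hy
    have hpq : p ≠ q := by rintro rfl; exact hxy rfl
    obtain ⟨h1, h2⟩ := hne p hp q hq hpq
    have hp' := hbox p hp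
    have hq' := hbox q hq
    rcases lt_or_gt_of_ne h1 with h1 | h1 <;> rcases lt_or_gt_of_ne h2 with h2 | h2
    · exact absurd (crosses_of_unrollPair_lt h1 (by omega) h2) (hX p hp q hq)
    · exact Or.inl ⟨h1, h2⟩
    · exact Or.inr ⟨h1, h2⟩
    · exact absurd (crosses_of_unrollPair_lt h1 (by omega) h2) (hX q hq p hp)

theorem redCount_val {N : ℕ} (C : ℕ → Bool) :
    redCount (fun i : Fin N => C i.val) =
      ((Finset.range N).filter fun z => C z = true).card := by
  unfold redCount
  rw [Finset.card_filter, Finset.card_filter,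
    ← Fin.sum_univ_eq_sum_range (fun z => if C z = true then 1 else 0)]

theorem monoCount_val_le {D m : ℕ} (hD : 0 < D) {C : ℕ → Bool}
    (hC : ∀ z z', z / D = z' / D → C z = C z') :
    monoCount (fun i : Fin (D * m) => C i.val) ≤ m := by
  unfold monoCount
  have hmod : ∀ i : Fin (D * m), C i.val ≠ C ((i.val + 1) % (D * m)) → (i.val + 1) % D = 0 := by
    intro i hi
    by_contra hne
    have hlt : i.val + 1 < D * m := by
      rcases Nat.lt_or_ge (i.val + 1) (D * m) with h | h
      · exact h
      · have : i.val + 1 = D * m := by have := i.isLt; omega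
        rw [this, Nat.mul_mod_right] at hne
        exact absurd rfl hne
    rw [Nat.mod_eq_of_lt hlt] at hi
    refine hi (hC _ _ ?_)
    rw [Nat.succ_div_of_not_dvd fun h => hne (Nat.mod_eq_zero_of_dvd h)]
  conv_rhs => rw [← Finset.card_range m]
  refine Finset.card_le_card_of_injOn (fun i => i.val / D) (fun i _ => ?_) ?_
  · simp only [Finset.coe_range, Set.mem_Iio]
    exact Nat.div_lt_of_lt_mul i.isLt
  · intro i hi j hj hij
    have h1 := hmod i (Finset.mem_filter.1 hi).2
    have h2 := hmod j (Finset.mem_filter.1 hj).2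
    obtain ⟨s, hs⟩ := Nat.dvd_of_mod_eq_zero h1
    obtain ⟨t, ht⟩ := Nat.dvd_of_mod_eq_zero h2
    have hdiv : ∀ z s, z + 1 = D * s → z / D + 1 = s := fun z s h => by
      have : (z + 1) / D = z / D + 1 := Nat.succ_div_of_dvd (h ▸ Dvd.intro _ rfl)
      rw [← this, h, Nat.mul_div_cancel_left _ hD]
    have : s = t := by
      rw [← hdiv _ _ hs, ← hdiv _ _ ht]
      exact congrArg (· + 1) hij
    subst this
    exact Fin.ext (by omega)

/-- Impurity densities `g' / (g + g')` just above `1 - 1 / √2`. -/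
theorem exists_impurity_density {δ : ℝ} (hδ : 0 < δ) :
    ∃ g g' : ℕ, 0 < g ∧ (1 : ℝ) ≤ g' / g + 2 * (g' / (g + g' : ℕ)) ∧
      (g' / (g + g' : ℕ) : ℝ) ≤ 1 - Real.sqrt 2 / 2 + δ := by
  have hs : Real.sqrt 2 ^ 2 = 2 := Real.sq_sqrt (by norm_num)
  have hs0 : 0 ≤ Real.sqrt 2 := Real.sqrt_nonneg 2
  have hs1 : 1 < Real.sqrt 2 := by nlinarith
  have hs2 : Real.sqrt 2 < 2 := by nlinarith
  obtain ⟨r, hr1, hr2⟩ := exists_rat_btwn (x := 1 - Real.sqrt 2 / 2)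
    (y := min (1 - Real.sqrt 2 / 2 + δ) 1) (lt_min (by linarith) (by linarith))
  have hr3 := hr2.trans_le (min_le_left _ _)
  have hr4 := hr2.trans_le (min_le_right _ _)
  have hr0 : (0 : ℝ) < r := by linarith
  have hr0' : 0 < r := by exact_mod_cast hr0
  have hr4' : r < 1 := by exact_mod_cast hr4
  have hnum : ((r.num.toNat : ℕ) : ℤ) = r.num :=
    Int.toNat_of_nonneg (Rat.num_nonneg.2 hr0'.le)
  have hlt : r.num.toNat < r.den := by
    have := Rat.num_lt_denom_iff.2 hr4'
    omega
  have hden : (0 : ℝ) < r.den := by exact_mod_cast r.den_pos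
  have hr : (r.num.toNat : ℝ) = r * r.den := by
    have h1 : (r : ℝ) = r.num / r.den := by exact_mod_cast (Rat.num_div_den r).symm
    rw [h1, div_mul_cancel₀ _ hden.ne']
    exact_mod_cast congrArg (Int.cast : ℤ → ℝ) hnum
  refine ⟨r.den - r.num.toNat, r.num.toNat, by omega, ?_, ?_⟩
  · rw [Nat.sub_add_cancel hlt.le, Nat.cast_sub hlt.le, hr]
    have h1 : (r.den : ℝ) - r * r.den = (1 - r) * r.den := by ring
    rw [h1, mul_div_mul_right _ _ hden.ne', mul_div_cancel_right₀ _ hden.ne']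
    have h2 : (0 : ℝ) < 1 - r := by linarith
    rw [div_add' _ _ _ h2.ne', le_div_iff₀ h2]
    nlinarith
  · rw [Nat.sub_add_cancel hlt.le, hr, mul_div_cancel_right₀ _ hden.ne']
    exact hr3.le

/-- for every ε > 0 and N₀ there is a balanced necklace on
N = 2n ≥ N₀ beads with mono(L) ≤ ε·N such that every proper heterogeneous
matching has size at most (2 − √2 + ε)·n. -/
theorem stmt6 (ε : ℝ) (hε : 0 < ε) (N₀ : ℕ) :
    ∃ n : ℕ, N₀ ≤ 2 * n ∧ ∃ c : Fin (2 * n) → Bool,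
      redCount c = n ∧
      (monoCount c : ℝ) ≤ ε * (2 * n) ∧
      ∀ M : Finset (Fin (2 * n) × Fin (2 * n)),
        IsMatching M → IsProper M → Heterogeneous c M →
        (M.card : ℝ) ≤ (2 - Real.sqrt 2 + ε) * n := by
  obtain ⟨g, g', hg, hq, hq'⟩ := exists_impurity_density (δ := ε / 8) (by positivity)
  obtain ⟨h, hh⟩ : ∃ h, h = g + g' := ⟨_, rfl⟩
  rw [← hh] at hq hq'
  have hh0 : 0 < h := by omega
  obtain ⟨K, hK⟩ := exists_nat_gt (16 / ε)
  obtain ⟨D, hD⟩ := exists_nat_gt (8 * (h + 52) / ε + N₀)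
  have hKR : (0 : ℝ) < K := lt_trans (by positivity) hK
  have hDR' : 8 * (h + 52) / ε < D := by
    have : (0 : ℝ) ≤ N₀ := Nat.cast_nonneg _
    linarith
  have hDR : (0 : ℝ) < D := lt_trans (by positivity) hDR'
  have hK0 : 0 < K := by exact_mod_cast hKR
  have hD0 : 0 < D := by exact_mod_cast hDR
  have hDN : N₀ ≤ D := by
    have h1 : (0 : ℝ) < 8 * (h + 52) / ε := by positivity
    have : (N₀ : ℝ) ≤ D := by linarith
    exact_mod_cast this
  have hN : 2 * (K * (h * D ^ (2 * K + 1))) = K * (2 * (h * D ^ (2 * K + 1))) := by ring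
  have hND : 2 * (K * (h * D ^ (2 * K + 1))) = D * (2 * K * h * D ^ (2 * K)) := by ring
  set n := K * (h * D ^ (2 * K + 1)) with hn
  have hper := segmentColor_periodic g hD0 hK0 hh0
  have hred := card_segmentColor (K := K) g hD0 hh0
  set L := 2 * (h * D ^ (2 * K + 1)) with hL
  have hKL : (K * L : ℝ) = 2 * n := by exact_mod_cast hN.symm
  have hε1 : (h + 52 : ℝ) / D ≤ ε / 8 := by
    rw [div_lt_iff₀ hε] at hDR'
    rw [div_le_iff₀ hDR]
    linarith
  have hε2 : (2 : ℝ) / K ≤ ε / 8 := by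
    rw [div_lt_iff₀ hε] at hK
    rw [div_le_iff₀ hKR]
    linarith
  refine ⟨n, ?_, fun i => segmentColor D K h g L i.val, ?_, ?_, ?_⟩
  · refine hDN.trans (Nat.le_of_dvd ?_ (hND ▸ Dvd.intro _ rfl))
    positivity
  · rw [redCount_val, hN, hred]
  · have h1 : ∀ N, N = D * (2 * K * h * D ^ (2 * K)) →
        monoCount (fun i : Fin N => segmentColor D K h g L i.val) ≤ 2 * K * h * D ^ (2 * K) := by
      rintro N rfl
      exact monoCount_val_le hD0 fun z z' hz => segmentColor_congr hz
    have h2 : (2 * n : ℝ) = D * (2 * K * h * D ^ (2 * K) : ℕ) := by exact_mod_cast hND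
    rw [h2]
    refine (Nat.cast_le.2 (h1 _ hND)).trans ?_
    have h3 : 1 ≤ ε * D := by
      rw [div_le_iff₀ hDR] at hε1
      have : (0 : ℝ) ≤ h := Nat.cast_nonneg _
      linarith
    rw [← mul_assoc]
    exact le_mul_of_one_le_left (Nat.cast_nonneg _) h3
  · rintro M hM ⟨hX, k, m, hS⟩ hH
    rw [← hN] at hper
    obtain ⟨hinj, hfold⟩ := isFold_unrollPair hper hM hX hH hS
    rw [← Finset.card_image_of_injOn hinj]
    have h1 := hS.2.1
    have h2 := card_fold_le (L := L) (k := k) (m := m) hD0 hK0 hg hh hL hq (by omega)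
      (by rw [← hN]; exact hfold)
    refine h2.trans ?_
    rw [hKL]
    have hn0 : (0 : ℝ) ≤ n := Nat.cast_nonneg _
    nlinarith
end

section
/- For every integer s ≥ 2, the necklace L of Construction B with parameter s satisfies mono(L) ≤ 8·s^{4s}; since N = 2s^{5s+1}, this is O(N^{4/5}) = o(N). -/
/-- The number of dust beads in a tiny interval of a big arc of L_i in
Construction B: ⌊λ·s^(2s−i)⌋ with λ = 1 − 1/√2. -/
noncomputable def dustLen (s i : ℕ) : ℕ :=
  ⌊(1 - 1 / Real.sqrt 2) * ((s : ℝ) ^ (2 * s - i))⌋₊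

/-- Construction B with parameter s (and λ = 1 − 1/√2): n = s^(5s+1), N = 2n;
s large arcs L_1, …, L_s; L_i consists of 2·s^(2s−i) arcs ℓ_{i,j} of length
s^(3s+i) each with alternating main colors; each ℓ_{i,j} is divided into
s^(s+2i) tiny intervals of length s^(2s−i), in each of which the last
⌊λ·s^(2s−i)⌋ beads get the opposite (dust) color. -/
noncomputable def constrB (s : ℕ) : Fin (2 * s ^ (5 * s + 1)) → Bool :=
  fun x =>
    let i := x.val / (2 * s ^ (5 * s)) + 1       -- 1-indexed large arc L_i
    let off := x.val % (2 * s ^ (5 * s))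
    let j := off / s ^ (3 * s + i)               -- 0-indexed arc ℓ_{i,j+1}
    let main : Bool := j % 2 == 0                -- main color: red iff j even
    let pos := (off % s ^ (3 * s + i)) % s ^ (2 * s - i)  -- position in tiny interval
    if s ^ (2 * s - i) - dustLen s i ≤ pos then !main else main

/-- The length of a tiny interval divides the length of an arc `ℓ_{i,j}`. -/
theorem tiny_dvd_arc (s i : ℕ) : s ^ (2 * s - i) ∣ s ^ (3 * s + i) :=
  pow_dvd_pow s (by omega)

theorem two_mul_pow_eq_tiny_mul {s i : ℕ} (hi : i ≤ s) :
    2 * s ^ (5 * s) = s ^ (2 * s - i) * (2 * s ^ (3 * s + i)) := by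
  rw [mul_left_comm, ← pow_add]
  congr 2
  omega

theorem mod_eq_sub_one_of_dvd_succ {t x : ℕ} (ht : 0 < t) (h : t ∣ x + 1) :
    x % t = t - 1 := by
  obtain ⟨k, hk⟩ := h
  obtain ⟨k, rfl⟩ : ∃ m, k = m + 1 := ⟨k - 1, by cases k <;> simp_all⟩
  have hx : x = t - 1 + t * k := by
    rw [mul_add] at hk
    omega
  rw [hx, Nat.add_mul_mod_self_left, Nat.mod_eq_of_lt (by omega)]

theorem succ_div_eq_of_not_dvd {x K : ℕ} (h : ¬ K ∣ x + 1) : (x + 1) / K = x / K := by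
  simp [Nat.succ_div, h]

theorem succ_mod_eq_of_not_dvd {x K : ℕ} (h : ¬ K ∣ x + 1) : (x + 1) % K = x % K + 1 := by
  have h1 := Nat.div_add_mod (x + 1) K
  have h2 := Nat.div_add_mod x K
  rw [succ_div_eq_of_not_dvd h] at h1
  omega

/-- In Construction B the color changes after a bead only if this bead is the last one of its
tiny interval, or the last one before the dust of its tiny interval. -/
theorem constrB_color_change {s : ℕ} (hs : 0 < s) (x : Fin (2 * s ^ (5 * s + 1)))
    (i : ℕ) (hi : i = x.val / (2 * s ^ (5 * s)) + 1) (his : i ≤ s)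
    (hx : constrB s x ≠
      constrB s ⟨(x.val + 1) % (2 * s ^ (5 * s + 1)), Nat.mod_lt _ x.pos⟩)
    (hlast : x.val % (2 * s ^ (5 * s)) % s ^ (2 * s - i) ≠ s ^ (2 * s - i) - 1) :
    x.val % (2 * s ^ (5 * s)) % s ^ (2 * s - i) = s ^ (2 * s - i) - dustLen s i - 1 := by
  have ht : 0 < s ^ (2 * s - i) := pow_pos hs _
  have htM : s ^ (2 * s - i) ∣ 2 * s ^ (5 * s) := ⟨_, two_mul_pow_eq_tiny_mul his⟩
  have hoff : ¬ s ^ (2 * s - i) ∣ x.val % (2 * s ^ (5 * s)) + 1 :=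
    fun h => hlast (mod_eq_sub_one_of_dvd_succ ht h)
  have hxt : ¬ s ^ (2 * s - i) ∣ x.val + 1 := fun h => hlast <| by
    rw [Nat.mod_mod_of_dvd _ htM]
    exact mod_eq_sub_one_of_dvd_succ ht h
  have hM : ¬ 2 * s ^ (5 * s) ∣ x.val + 1 := fun h => hxt (htM.trans h)
  have hN : ¬ 2 * s ^ (5 * s + 1) ∣ x.val + 1 :=
    fun h => hM ((mul_dvd_mul_left 2 (pow_dvd_pow s (Nat.le_succ _))).trans h)
  have hA : ¬ s ^ (3 * s + i) ∣ x.val % (2 * s ^ (5 * s)) + 1 :=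
    fun h => hoff ((tiny_dvd_arc s i).trans h)
  have hnext : (x.val + 1) % (2 * s ^ (5 * s + 1)) = x.val + 1 := by
    rw [succ_mod_eq_of_not_dvd hN, Nat.mod_eq_of_lt x.isLt]
  simp only [constrB, hnext, succ_div_eq_of_not_dvd hM, succ_mod_eq_of_not_dvd hM, ← hi,
    succ_div_eq_of_not_dvd hA, Nat.mod_mod_of_dvd _ (tiny_dvd_arc s i),
    succ_mod_eq_of_not_dvd hoff] at hx
  generalize x.val % (2 * s ^ (5 * s)) % s ^ (2 * s - i) = pos at hx ⊢
  generalize s ^ (2 * s - i) - dustLen s i = start at hx ⊢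
  clear * - hx
  split_ifs at hx <;> first | exact absurd rfl hx | omega

theorem sum_range_pow_succ_le {s : ℕ} (hs : 2 ≤ s) (m : ℕ) :
    ∑ i ∈ Finset.range m, s ^ (i + 1) ≤ 2 * s ^ m := by
  induction m with
  | zero => simp
  | succ m ih =>
    rw [Finset.sum_range_succ]
    have : 2 * s ^ m ≤ s ^ (m + 1) := by
      rw [pow_succ']
      exact Nat.mul_le_mul_right _ hs
    omega

/-- the necklace of Construction B satisfies mono(L) ≤ 8·s^(4s). -/
theorem stmt8 (s : ℕ) (hs : 2 ≤ s) :
    monoCount (constrB s) ≤ 8 * s ^ (4 * s) := by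
  set M := 2 * s ^ (5 * s) with hM
  have hs0 : 0 < s := by omega
  have hMpos : 0 < M := by positivity
  have hN : 2 * s ^ (5 * s + 1) = M * s := by rw [hM, pow_succ, mul_assoc]
  have hidx (x : Fin (2 * s ^ (5 * s + 1))) : x.val / M < s :=
    Nat.div_lt_of_lt_mul (hN ▸ x.isLt)
  let T : Finset (Σ _ : ℕ, ℕ × Bool) :=
    (Finset.range s).sigma fun i => Finset.range (2 * s ^ (3 * s + (i + 1))) ×ˢ Finset.univ
  let code : Fin (2 * s ^ (5 * s + 1)) → Σ _ : ℕ, ℕ × Bool := fun x =>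
    ⟨x.val / M, x.val % M / s ^ (2 * s - (x.val / M + 1)),
      decide (x.val % M % s ^ (2 * s - (x.val / M + 1)) =
        s ^ (2 * s - (x.val / M + 1)) - 1)⟩
  have hcard : monoCount (constrB s) ≤ T.card := by
    refine Finset.card_le_card_of_injOn code ?_ ?_
    · intro x _
      simp only [code, T, Finset.coe_sigma, Set.mem_sigma_iff, Finset.mem_coe,
        Finset.mem_product, Finset.mem_range, Finset.mem_univ, and_true]
      refine ⟨hidx x, Nat.div_lt_of_lt_mul ?_⟩
      rw [← two_mul_pow_eq_tiny_mul (hidx x)]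
      exact Nat.mod_lt _ hMpos
    · intro x hx y hy hxy
      have hx := (Finset.mem_filter.mp hx).2
      have hy := (Finset.mem_filter.mp hy).2
      have hcx := constrB_color_change hs0 x _ rfl (hidx x) hx
      have hcy := constrB_color_change hs0 y _ rfl (hidx y) hy
      simp only [code, Sigma.mk.injEq, heq_eq_eq, Prod.mk.injEq, decide_eq_decide] at hxy
      obtain ⟨hi, hq, hb⟩ := hxy
      rw [← hM] at hcx hcy
      rw [← hi] at hcy hq hb
      have hpos : x.val % M % s ^ (2 * s - (x.val / M + 1)) =
          y.val % M % s ^ (2 * s - (x.val / M + 1)) := by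
        by_cases h : x.val % M % s ^ (2 * s - (x.val / M + 1)) =
            s ^ (2 * s - (x.val / M + 1)) - 1
        · rw [h, hb.mp h]
        · rw [hcx h, hcy fun h' => h (hb.mpr h')]
      have hoff : x.val % M = y.val % M := by
        rw [← Nat.div_add_mod (x.val % M) (s ^ (2 * s - (x.val / M + 1))), hq, hpos,
          Nat.div_add_mod]
      apply Fin.ext
      rw [← Nat.div_add_mod x.val M, hi, hoff, Nat.div_add_mod]
  calc monoCount (constrB s) ≤ T.card := hcard
    _ = 4 * s ^ (3 * s) * ∑ i ∈ Finset.range s, s ^ (i + 1) := by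
        simp only [T, Finset.card_sigma, Finset.card_product, Finset.card_range,
          Finset.card_univ, Fintype.card_bool, Finset.mul_sum]
        exact Finset.sum_congr rfl fun i _ => by ring
    _ ≤ 4 * s ^ (3 * s) * (2 * s ^ s) :=
        Nat.mul_le_mul_left _ (sum_range_pow_succ_le hs s)
    _ = 8 * s ^ (4 * s) := by
        rw [show 4 * s = 3 * s + s by ring, pow_add]
        ring
end

section
/- Let λ = 1 − 1/√2 and let S, T be real numbers with 0 ≤ 2S < T. Then for all real A ∈ [0, (√2+1)T], B ∈ [0, (√2−1)T], C ∈ [0, T], D ∈ [0, T], one has 2(λA + (1−λ)B + λC + (1−λ)D)/(A + B + C + D + 2T − 4S) ≤ 2λ + 8λS/((√2+2)T − 4S). (Note that (1−λ)/λ = √2+1, λ/(1−λ) = √2−1, and λ/(1−λ) + 3 = √2+2.) -/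
/-- with λ = 1 − 1/√2 and 0 ≤ 2S < T, for all
A ∈ [0, (√2+1)T], B ∈ [0, (√2−1)T], C ∈ [0, T], D ∈ [0, T] we have
2(λA + (1−λ)B + λC + (1−λ)D)/(A + B + C + D + 2T − 4S)
  ≤ 2λ + 8λS/((√2+2)T − 4S). -/
theorem stmt11 (lam S T A B C D : ℝ)
    (hlam : lam = 1 - 1 / Real.sqrt 2)
    (hS : 0 ≤ 2 * S) (hST : 2 * S < T)
    (hA0 : 0 ≤ A) (hA1 : A ≤ (Real.sqrt 2 + 1) * T)
    (hB0 : 0 ≤ B) (hB1 : B ≤ (Real.sqrt 2 - 1) * T)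
    (hC0 : 0 ≤ C) (hC1 : C ≤ T)
    (hD0 : 0 ≤ D) (hD1 : D ≤ T) :
    2 * (lam * A + (1 - lam) * B + lam * C + (1 - lam) * D) /
        (A + B + C + D + 2 * T - 4 * S)
      ≤ 2 * lam + 8 * lam * S / ((Real.sqrt 2 + 2) * T - 4 * S) := by
  set r := Real.sqrt 2
  have hr2 : r * r = 2 := Real.mul_self_sqrt (by norm_num)
  have hr0 : 0 < r := Real.sqrt_pos.2 (by norm_num)
  have hr1 : 1 < r := by nlinarith
  have hlam' : lam = r * (r - 1) / 2 := by
    rw [hlam]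
    field_simp
    linear_combination (1 - r) * hr2
  have hlam0 : 0 < lam := by
    rw [hlam']
    exact div_pos (mul_pos hr0 (by linarith)) two_pos
  have hT : 0 < T := by linarith
  have hrT : 0 ≤ r * (T - 2 * S) := mul_nonneg hr0.le (by linarith)
  have hrS : 0 ≤ r * S := mul_nonneg hr0.le (by linarith)
  have hq : 0 < (r + 2) * T - 4 * S := by linarith
  have hX : 0 < A + B + C + D + 2 * T - 4 * S := by linarith
  have hu : 0 ≤ r * T - (B + D) := by linarith
  have hkey : 0 ≤ 2 * (r - 1) * ((r + 2) * T - 4 * S - 2 * r * S) :=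
    mul_nonneg (by linarith) (by linarith)
  have hAC : 0 ≤ 8 * lam * S * (A + C) :=
    mul_nonneg (mul_nonneg (by linarith) (by linarith)) (by linarith)
  have hprod := mul_nonneg hu hkey
  have hle : (2 * (lam * A + (1 - lam) * B + lam * C + (1 - lam) * D)
      - 2 * lam * (A + B + C + D + 2 * T - 4 * S)) * ((r + 2) * T - 4 * S)
      ≤ 8 * lam * S * (A + B + C + D + 2 * T - 4 * S) := by
    have hnum : 2 * (lam * A + (1 - lam) * B + lam * C + (1 - lam) * D)
        - 2 * lam * (A + B + C + D + 2 * T - 4 * S)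
        = 8 * lam * S - 2 * (r - 1) * (r * T - (B + D)) := by
      rw [hlam']
      linear_combination (-2 * (B + D)) * hr2
    have hlamS : 8 * lam * S = 4 * r * (r - 1) * S := by rw [hlam']; ring
    rw [hnum]
    rw [hlamS] at hAC ⊢
    linarith
  have hdiv := (div_le_div_iff₀ hX hq).2 hle
  rw [sub_div, mul_div_cancel_right₀ _ hX.ne'] at hdiv
  linarith
end
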